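/- Let 1 ≤ d' ≤ d, r ≥ 1, d ≥ 1 be integers, 1 ≤ p ≤ ∞, and let φ : ℝ^{d'} → ℝ be infinitely continuously differentiable in some open ball in ℝ^{d'}, with a point b in this ball such that D^k φ(b) ≠ 0 for every multi-index k ∈ ℤ^{d'}, k ≥ 0. Then for every n there exist d'×d matrices A_1, …, A_n (independent of f) with the following property: for any function f on [−1,1]^d with continuous partial derivatives up to order r, there exist coefficients a_1(f), …, a_n(f) such that ‖f − Σ_{j=1}^n a_j(f) φ(A_j(·) + b)‖_p ≤ c n^{−r/d} ‖f‖_{W^p_{r,d}}, where c is a constant independent of f and n. -/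

import Mathlib

open MeasureTheory
open scoped ENNReal NNReal

/-- The partial derivative of `g : ℝ^d → ℝ` in the `j`-th coordinate direction. -/
noncomputable def partialDeriv {d : ℕ} (j : Fin d) (g : (Fin d → ℝ) → ℝ) :
    (Fin d → ℝ) → ℝ :=
  fun x => fderiv ℝ g x (Pi.single j 1)

/-- The multi-index partial derivative `D^k g` for a multi-index `k : Fin d → ℕ`:
the `j`-th partial derivative is applied `k j` times, for each `j`. -/
noncomputable def multiPartial {d : ℕ} (k : Fin d → ℕ) (g : (Fin d → ℝ) → ℝ) :
    (Fin d → ℝ) → ℝ :=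
  (List.finRange d).foldr (fun j G => (partialDeriv j)^[k j] G) g

/-- The cube `[-1,1]^d`. -/
def symCube (d : ℕ) : Set (Fin d → ℝ) := Set.univ.pi fun _ => Set.Icc (-1) 1

/-- The `L^p` norm of `g` on the cube `[-1,1]^d` (essential supremum for `p = ∞`). -/
noncomputable def lpNormOnCube (d : ℕ) (p : ℝ≥0∞) (g : (Fin d → ℝ) → ℝ) : ℝ≥0∞ :=
  eLpNorm g p (volume.restrict (symCube d))

/-- The Sobolev norm `‖f‖_{W^p_{r,d}} = Σ_{0 ≤ |k| ≤ r} ‖D^k f‖_p`, the sum over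
multi-indices `k` with `|k| ≤ r` of the `L^p` norms on `[-1,1]^d` of the partial
derivatives `D^k f`. -/
noncomputable def sobolevNorm (d r : ℕ) (p : ℝ≥0∞) (f : (Fin d → ℝ) → ℝ) : ℝ≥0∞ :=
  ∑ k ∈ (Fintype.piFinset fun _ : Fin d => Finset.range (r + 1)).filter
      (fun k => ∑ j, k j ≤ r),
    lpNormOnCube d p (multiPartial k f)

/-- truncated power -/
noncomputable def tpow (s : ℕ) (t : ℝ) : ℝ := if 0 < t then t ^ s else 0

lemma exists_sin_poly (l : ℕ) : ∃ P : Polynomial ℝ, P.natDegree ≤ 2 * l ∧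
    ∀ u : ℝ, Real.sin ((2 * l + 1) * u) = Real.sin u * P.eval (Real.sin u) := by
  have key : ∀ l : ℕ, (∃ P : Polynomial ℝ, P.natDegree ≤ 2 * l ∧
      ∀ u : ℝ, Real.sin ((2 * l + 1) * u) = Real.sin u * P.eval (Real.sin u)) ∧
      (∃ P : Polynomial ℝ, P.natDegree ≤ 2 * (l + 1) ∧
      ∀ u : ℝ, Real.sin ((2 * (l + 1 : ℕ) + 1) * u) = Real.sin u * P.eval (Real.sin u)) := by
    intro l
    induction l with
    | zero =>
      refine ⟨⟨1, by simp, by simp⟩, ⟨3 - 4 * Polynomial.X ^ 2, by compute_degree, ?_⟩⟩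
      intro u
      have h : ((2 * ((0 + 1 : ℕ) : ℝ) + 1) * u) = 3 * u := by push_cast; ring
      rw [h, Real.sin_three_mul]
      simp
      ring
    | succ l ih =>
      obtain ⟨⟨P, hP, hP'⟩, ⟨R, hR, hR'⟩⟩ := ih
      refine ⟨⟨R, hR, hR'⟩, ⟨(2 - 4 * Polynomial.X ^ 2) * R - P, ?_, ?_⟩⟩
      · refine (Polynomial.natDegree_sub_le _ _).trans (max_le ?_ (by omega))
        refine Polynomial.natDegree_mul_le.trans ?_
        have : (2 - 4 * Polynomial.X ^ 2 : Polynomial ℝ).natDegree ≤ 2 := by compute_degree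
        omega
      · intro u
        have h1 : Real.sin ((2 * ((l + 1 + 1 : ℕ) : ℝ) + 1) * u) =
            Real.sin ((2 * ((l + 1 : ℕ) : ℝ) + 1) * u + 2 * u) := by
          congr 1; push_cast; ring
        have h2 : Real.sin ((2 * (l : ℝ) + 1) * u) =
            Real.sin ((2 * ((l + 1 : ℕ) : ℝ) + 1) * u - 2 * u) := by
          congr 1; push_cast; ring
        have h3 := hP' u
        rw [h2, Real.sin_sub] at h3
        have h4 := hR' u
        rw [h1, Real.sin_add]
        have h5 : Real.cos (2 * u) = 1 - 2 * Real.sin u ^ 2 := by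
          rw [Real.cos_two_mul, Real.cos_sq']; ring
        simp only [Polynomial.eval_sub, Polynomial.eval_mul, Polynomial.eval_pow,
          Polynomial.eval_X, Polynomial.eval_ofNat]
        rw [h5] at h3 ⊢
        rw [h4] at h3 ⊢
        linear_combination -h3
  exact (key l).1

lemma exists_antideriv (p : Polynomial ℝ) : ∃ P : Polynomial ℝ,
    P.natDegree ≤ p.natDegree + 1 ∧ Polynomial.derivative P = p := by
  refine ⟨∑ i ∈ Finset.range (p.natDegree + 1),
    Polynomial.C (p.coeff i / (i + 1)) * Polynomial.X ^ (i + 1), ?_, ?_⟩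
  · refine Polynomial.natDegree_sum_le_of_forall_le _ _ ?_
    intro i hi
    refine (Polynomial.natDegree_C_mul_X_pow_le _ _).trans ?_
    have := Finset.mem_range.1 hi
    omega
  · rw [Polynomial.derivative_sum]
    conv_rhs => rw [p.as_sum_range_C_mul_X_pow]
    refine Finset.sum_congr rfl fun i _ => ?_
    rw [Polynomial.derivative_C_mul_X_pow]
    simp only [Nat.add_sub_cancel]
    congr 2
    have : ((i : ℝ) + 1) ≠ 0 := by positivity
    push_cast
    field_simp

lemma abs_sin_nat_mul_le (N : ℕ) (u : ℝ) : |Real.sin (N * u)| ≤ N * |Real.sin u| := by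
  induction N with
  | zero => simp
  | succ n ih =>
    push_cast
    rw [add_mul, one_mul, Real.sin_add]
    calc _ ≤ |Real.sin (n * u)| * |Real.cos u| + |Real.cos (n * u)| * |Real.sin u| := by
          refine (abs_add_le _ _).trans ?_
          rw [abs_mul, abs_mul]
      _ ≤ |Real.sin (n * u)| * 1 + 1 * |Real.sin u| := by
          gcongr
          · exact Real.abs_cos_le_one _
          · exact Real.abs_cos_le_one _
      _ ≤ _ := by nlinarith

lemma exists_kernel (m : ℕ) (hm : 1 ≤ m) : ∃ K : Polynomial ℝ, K.natDegree ≤ 8 * m ∧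
    (∀ t, 0 ≤ K.eval t) ∧
    (∀ t ∈ Set.Icc (-1 : ℝ) 1, |t| * K.eval t ≤
      4 * |t| * (2 * m + 1) ^ 4 / (1 + (2 * m + 1) ^ 2 * t ^ 2) ^ 2) ∧
    (∀ t ∈ Set.Ioo (0 : ℝ) (1 / (2 * m + 1)), ((2 * m + 1) / 2) ^ 4 ≤ K.eval t) := by
  obtain ⟨D, hD, hD'⟩ := exists_sin_poly m
  refine ⟨D ^ 4, ?_, ?_, ?_, ?_⟩
  · refine Polynomial.natDegree_pow_le.trans ?_
    omega
  · intro t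
    rw [Polynomial.eval_pow]
    positivity
  · intro t ht
    rcases eq_or_ne t 0 with rfl | h0
    · simp
    have hs : Real.sin (Real.arcsin t) = t := Real.sin_arcsin ht.1 ht.2
    have h1 := hD' (Real.arcsin t)
    rw [hs] at h1
    have h2 : |t * D.eval t| ≤ 1 := by rw [← h1]; exact Real.abs_sin_le_one _
    have h3 : |t * D.eval t| ≤ (2 * m + 1) * |t| := by
      rw [← h1]
      have := abs_sin_nat_mul_le (2 * m + 1) (Real.arcsin t)
      rw [hs] at this
      push_cast at this
      exact this
    have h4 : |D.eval t| ≤ 2 * m + 1 := by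
      rw [abs_mul] at h3
      have : 0 < |t| := abs_pos.2 h0
      nlinarith
    have h5 : (D.eval t) ^ 2 ≤ (2 * m + 1) ^ 2 := by
      rw [← sq_abs]; gcongr
    have h6 : (t * D.eval t) ^ 2 ≤ 1 := by
      rw [← sq_abs]; exact pow_le_one₀ (abs_nonneg _) h2
    rw [le_div_iff₀ (by positivity), Polynomial.eval_pow]
    set x := D.eval t
    set N : ℝ := 2 * m + 1
    have h7 : x ^ 2 * (1 + N ^ 2 * t ^ 2) ≤ 2 * N ^ 2 := by
      have : N ^ 2 * (t * x) ^ 2 ≤ N ^ 2 * 1 := by gcongr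
      nlinarith
    have h8 : (x ^ 2 * (1 + N ^ 2 * t ^ 2)) ^ 2 ≤ (2 * N ^ 2) ^ 2 := by
      gcongr
    have : |t| * (x ^ 2 * (1 + N ^ 2 * t ^ 2)) ^ 2 ≤ |t| * (2 * N ^ 2) ^ 2 := by gcongr
    nlinarith
  · intro t ht
    have hN : (0 : ℝ) < 2 * m + 1 := by positivity
    have ht1 : t < 1 := by
      refine ht.2.trans_le ?_
      rw [div_le_one hN]
      have : (0 : ℝ) ≤ m := by positivity
      linarith
    have hs : Real.sin (Real.arcsin t) = t := Real.sin_arcsin (by linarith [ht.1]) ht1.le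
    have hu0 : 0 ≤ Real.arcsin t := Real.arcsin_nonneg.2 ht.1.le
    have hu1 : Real.arcsin t ≤ Real.pi / 2 := Real.arcsin_le_pi_div_two t
    have h1 := hD' (Real.arcsin t)
    rw [hs] at h1
    have h2 := Real.mul_le_sin hu0 hu1
    rw [hs] at h2
    set u := Real.arcsin t
    have hpi := Real.pi_pos
    have h3 : u ≤ Real.pi / 2 * t := by
      rw [div_mul_eq_mul_div, div_le_iff₀ hpi] at h2
      linarith
    have htN : (2 * m + 1) * t < 1 := by
      have := ht.2
      rw [lt_div_iff₀ hN] at this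
      linarith
    have h4 : (2 * m + 1) * u ≤ Real.pi / 2 := by
      calc (2 * m + 1) * u ≤ (2 * m + 1) * (Real.pi / 2 * t) := by gcongr
        _ = Real.pi / 2 * ((2 * m + 1) * t) := by ring
        _ ≤ Real.pi / 2 * 1 := by gcongr
        _ = _ := mul_one _
    have h5 := Real.mul_le_sin (by positivity) h4
    rw [h1] at h5
    have h6 : t ≤ u := by rw [← hs]; exact Real.sin_le hu0
    have h7 : (1 : ℝ) / 2 ≤ 2 / Real.pi := by
      rw [div_le_div_iff₀ (by norm_num) hpi]
      linarith [Real.pi_le_four]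
    have h8 : (2 * (m : ℝ) + 1) / 2 ≤ D.eval t := by
      have : 1 / 2 * ((2 * (m : ℝ) + 1) * t) ≤ t * D.eval t := by
        refine le_trans ?_ h5
        have := ht.1
        gcongr
      have h9 := ht.1
      have : t * ((2 * (m : ℝ) + 1) / 2) ≤ t * D.eval t := by linarith
      exact le_of_mul_le_mul_left this h9
    rw [Polynomial.eval_pow]
    gcongr

lemma tpow_mono (s : ℕ) : Monotone (tpow s) := by
  intro a b hab
  unfold tpow
  split_ifs with h1 h2 h2
  · gcongr
  · linarith
  · positivity
  · exact le_rfl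

lemma tpow_int (s : ℕ) (a b : ℝ) : IntervalIntegrable (tpow s) volume a b :=
  (tpow_mono s).intervalIntegrable

lemma tpow_meas (s : ℕ) : Measurable (tpow s) := (tpow_mono s).measurable

lemma integral_tpow (s : ℕ) (a t : ℝ) (ha : a ≤ 0) :
    ∫ y in a..t, tpow s y = tpow (s + 1) t / (s + 1) := by
  have hneg : ∀ b ≤ 0, ∫ y in a..b, tpow s y = 0 := by
    intro b hb
    rw [intervalIntegral.integral_congr (g := fun _ => (0 : ℝ))]
    · simp
    · intro y hy
      have : y ≤ 0 := hy.2.trans (max_le ha hb)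
      simp [tpow, not_lt.2 this]
  rcases le_or_gt t 0 with h | h
  · rw [hneg t h]
    simp [tpow, not_lt.2 h]
  · rw [← intervalIntegral.integral_add_adjacent_intervals (tpow_int s a 0) (tpow_int s 0 t),
      hneg 0 le_rfl, zero_add]
    have : ∫ y in (0:ℝ)..t, tpow s y = ∫ y in (0:ℝ)..t, y ^ s := by
      rw [intervalIntegral.integral_of_le h.le, intervalIntegral.integral_of_le h.le]
      refine setIntegral_congr_fun measurableSet_Ioc fun y hy => ?_
      simp [tpow, hy.1]
    rw [this, integral_pow]
    simp [tpow, h]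

lemma integral_poly_deriv (P p : Polynomial ℝ) (h : Polynomial.derivative P = p) (a b : ℝ) :
    ∫ y in a..b, p.eval y = P.eval b - P.eval a := by
  subst h
  exact intervalIntegral.integral_eq_sub_of_hasDerivAt (fun x _ => P.hasDerivAt x)
    ((Polynomial.continuous _).intervalIntegrable _ _)

lemma enorm_intervalIntegral_le (f : ℝ → ℝ) {a b : ℝ} (hab : a ≤ b) :
    ‖∫ y in a..b, f y‖ₑ ≤ ∫⁻ y in Set.Icc a b, ‖f y‖ₑ := by
  rw [intervalIntegral.integral_of_le hab, ← integral_Icc_eq_integral_Ioc]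
  exact enorm_integral_le_lintegral_enorm _

lemma intervalIntegral_eq_lintegral (f : ℝ → ℝ) {a b : ℝ} (hab : a ≤ b)
    (hf : IntervalIntegrable f volume a b) :
    ∫⁻ y in Set.Icc a b, ‖f y‖ₑ = ENNReal.ofReal (∫ y in a..b, |f y|) := by
  rw [intervalIntegral.integral_of_le hab, ← integral_Icc_eq_integral_Ioc,
    ofReal_integral_eq_lintegral_ofReal]
  · refine lintegral_congr fun y => ?_
    rw [← Real.enorm_abs, Real.enorm_of_nonneg (abs_nonneg _)]
  · exact ((intervalIntegrable_iff_integrableOn_Icc_of_le hab).1 hf).abs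
  · exact Filter.Eventually.of_forall fun y => abs_nonneg _

lemma heaviside_approx (m : ℕ) (hm : 1 ≤ m) : ∃ P : Polynomial ℝ, P.natDegree ≤ 8 * m + 1 ∧
    ∫ t in (-1 : ℝ)..1, |tpow 0 t - P.eval t| ≤ 64 / m := by
  obtain ⟨K, hK, hK0, hK1, hK2⟩ := exists_kernel m hm
  obtain ⟨κ₀, hκ, hκ'⟩ := exists_antideriv K
  have hI : ∀ a b, IntervalIntegrable (fun t => K.eval t) volume a b := fun a b =>
    (Polynomial.continuous _).intervalIntegrable _ _
  set N : ℝ := 2 * m + 1 with hN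
  have hmr : (1 : ℝ) ≤ m := by exact_mod_cast hm
  have hNpos : 0 < N := by positivity
  set κ : Polynomial ℝ := κ₀ - Polynomial.C (κ₀.eval (-1)) with hκdef
  have hκd : Polynomial.derivative κ = K := by simp [hκdef, hκ']
  have hκn : κ.natDegree ≤ 8 * m + 1 := by
    rw [hκdef, Polynomial.natDegree_sub_C]; omega
  have hκm1 : κ.eval (-1) = 0 := by simp [hκdef]
  have hKint : ∀ a b, ∫ y in a..b, K.eval y = κ.eval b - κ.eval a :=
    integral_poly_deriv κ K hκd
  have hmono : ∀ a b, a ≤ b → κ.eval a ≤ κ.eval b := by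
    intro a b hab
    have := intervalIntegral.integral_nonneg (μ := volume) hab (fun u _ => hK0 u)
    rw [hKint] at this
    linarith
  set Z := κ.eval 1 with hZ
  have hZlow : N ^ 3 / 16 ≤ Z := by
    have h1 : ∫ y in (0:ℝ)..(1 / N), (N / 2) ^ 4 ≤ ∫ y in (0:ℝ)..(1 / N), K.eval y := by
      apply intervalIntegral.integral_mono_on_of_le_Ioo (by positivity) (by simp) (hI _ _)
      intro x hx
      exact hK2 x hx
    rw [hKint, intervalIntegral.integral_const, smul_eq_mul] at h1
    have h2 : (1 / N - 0) * (N / 2) ^ 4 = N ^ 3 / 16 := by field_simp; norm_num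
    rw [h2] at h1
    have h3 := hmono (-1) 0 (by norm_num)
    have h4 := hmono (1 / N) 1 (by rw [div_le_one hNpos]; linarith)
    linarith
  have hZpos : 0 < Z := lt_of_lt_of_le (by positivity) hZlow
  refine ⟨Polynomial.C (1 / Z) * κ, (Polynomial.natDegree_C_mul_le _ _).trans hκn, ?_⟩
  have hcI : ∀ a b, IntervalIntegrable (fun t => |tpow 0 t - (Polynomial.C (1 / Z) * κ).eval t|)
      volume a b := fun a b =>
    ((tpow_int 0 a b).sub ((Polynomial.continuous _).intervalIntegrable _ _)).abs
  rw [← intervalIntegral.integral_add_adjacent_intervals (hcI (-1) 0) (hcI 0 1)]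
  have cκ := κ.continuous
  have cK := K.continuous
  have hL : ∫ t in (-1:ℝ)..0, |tpow 0 t - (Polynomial.C (1 / Z) * κ).eval t| =
      (1 / Z) * ∫ t in (-1:ℝ)..0, -t * K.eval t := by
    have h1 : ∫ t in (-1:ℝ)..0, (κ.eval t + t * K.eval t) = 0 := by
      have h := intervalIntegral.integral_eq_sub_of_hasDerivAt (a := -1) (b := 0)
        (f := fun t => t * κ.eval t) (f' := fun t => 1 * κ.eval t + t * K.eval t)
        (fun x _ => (hasDerivAt_id x).mul (by simpa [hκd] using κ.hasDerivAt x))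
        (Continuous.intervalIntegrable (by fun_prop) _ _)
      simp only [one_mul] at h
      rw [h, hκm1]; simp
    rw [intervalIntegral.integral_add (Continuous.intervalIntegrable (by fun_prop) _ _)
      (Continuous.intervalIntegrable (by fun_prop) _ _)] at h1
    have h2 : ∫ t in (-1:ℝ)..0, -t * K.eval t = ∫ t in (-1:ℝ)..0, κ.eval t := by
      simp only [neg_mul, intervalIntegral.integral_neg]; linarith
    rw [h2, ← intervalIntegral.integral_const_mul]
    apply intervalIntegral.integral_congr
    intro t ht
    rw [Set.uIcc_of_le (by norm_num)] at ht
    have h0 := hmono (-1) t ht.1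
    have : 0 ≤ 1 / Z * κ.eval t := mul_nonneg (by positivity) (by linarith)
    simp only [tpow, not_lt.2 ht.2, if_false, Polynomial.eval_mul, Polynomial.eval_C, zero_sub,
      abs_neg]
    exact abs_of_nonneg this
  have hR : ∫ t in (0:ℝ)..1, |tpow 0 t - (Polynomial.C (1 / Z) * κ).eval t| =
      (1 / Z) * ∫ t in (0:ℝ)..1, t * K.eval t := by
    have h1 : ∫ t in (0:ℝ)..1, ((Z - κ.eval t) - t * K.eval t) = 0 := by
      have h := intervalIntegral.integral_eq_sub_of_hasDerivAt (a := 0) (b := 1)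
        (f := fun t => t * (Z - κ.eval t)) (f' := fun t => 1 * (Z - κ.eval t) + t * (0 - K.eval t))
        (fun x _ => (hasDerivAt_id x).mul ((hasDerivAt_const x Z).sub
          (by simpa [hκd] using κ.hasDerivAt x)))
        (Continuous.intervalIntegrable (by fun_prop) _ _)
      have h' : ∀ t, Z - κ.eval t - t * K.eval t = 1 * (Z - κ.eval t) + t * (0 - K.eval t) := by
        intro t; ring
      simp only [h']
      rw [h]; simp [hZ]
    rw [intervalIntegral.integral_sub (Continuous.intervalIntegrable (by fun_prop) _ _)
      (Continuous.intervalIntegrable (by fun_prop) _ _)] at h1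
    have h2 : ∫ t in (0:ℝ)..1, t * K.eval t = ∫ t in (0:ℝ)..1, (Z - κ.eval t) := by linarith
    rw [h2, ← intervalIntegral.integral_const_mul, intervalIntegral.integral_of_le zero_le_one,
      intervalIntegral.integral_of_le zero_le_one]
    refine setIntegral_congr_fun measurableSet_Ioc fun t ht => ?_
    have h0 := hmono t 1 ht.2
    simp only [tpow, ht.1, if_true, Polynomial.eval_mul, Polynomial.eval_C, pow_zero]
    have : 1 - 1 / Z * κ.eval t = 1 / Z * (Z - κ.eval t) := by field_simp
    rw [this]
    exact abs_of_nonneg (mul_nonneg (by positivity) (by linarith))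
  have hG : ∀ t : ℝ, HasDerivAt (fun t => -2 * N ^ 2 / (1 + N ^ 2 * t ^ 2))
      (4 * t * N ^ 4 / (1 + N ^ 2 * t ^ 2) ^ 2) t := by
    intro t
    have hne : (1 + N ^ 2 * t ^ 2) ≠ 0 := by positivity
    have h1 : HasDerivAt (fun t : ℝ => 1 + N ^ 2 * t ^ 2) (N ^ 2 * (2 * t)) t := by
      have := ((hasDerivAt_pow 2 t).const_mul (N ^ 2)).const_add 1
      simpa using this
    refine ((hasDerivAt_const t (-2 * N ^ 2)).fun_div h1 hne).congr_deriv ?_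
    congr 1
    ring
  have hGc : Continuous (fun t : ℝ => 4 * t * N ^ 4 / (1 + N ^ 2 * t ^ 2) ^ 2) := by
    refine Continuous.div (by fun_prop) (by fun_prop) fun t => by positivity
  have hbd : ∫ t in (0:ℝ)..1, 4 * t * N ^ 4 / (1 + N ^ 2 * t ^ 2) ^ 2 ≤ 2 * N ^ 2 := by
    rw [intervalIntegral.integral_eq_sub_of_hasDerivAt (fun t _ => hG t)
      (hGc.intervalIntegrable _ _)]
    have : -2 * N ^ 2 / (1 + N ^ 2 * 1 ^ 2) ≤ 0 := by
      apply div_nonpos_of_nonpos_of_nonneg <;> nlinarith [sq_nonneg N]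
    simp only [ne_eq, OfNat.ofNat_ne_zero, not_false_eq_true, zero_pow, mul_zero, add_zero, div_one]
    linarith
  have hMR : ∫ t in (0:ℝ)..1, t * K.eval t ≤ 2 * N ^ 2 := by
    refine le_trans (intervalIntegral.integral_mono_on zero_le_one
      (Continuous.intervalIntegrable (by fun_prop) _ _) (hGc.intervalIntegrable _ _) ?_) hbd
    intro t ht
    have := hK1 t ⟨by linarith [ht.1], ht.2⟩
    rwa [abs_of_nonneg ht.1] at this
  have hML : ∫ t in (-1:ℝ)..0, -t * K.eval t ≤ 2 * N ^ 2 := by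
    have hc : ∫ t in (-1:ℝ)..0, -t * K.eval t = ∫ t in (0:ℝ)..1, t * K.eval (-t) := by
      have := intervalIntegral.integral_comp_neg (a := 0) (b := 1) (fun t => -t * K.eval t)
      simp only [neg_neg, neg_zero] at this
      exact this.symm
    rw [hc]
    refine le_trans (intervalIntegral.integral_mono_on zero_le_one
      (Continuous.intervalIntegrable (by fun_prop) _ _) (hGc.intervalIntegrable _ _) ?_) hbd
    intro t ht
    have := hK1 (-t) ⟨by linarith [ht.2], by linarith [ht.1]⟩
    rwa [abs_neg, abs_of_nonneg ht.1, neg_sq] at this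
  rw [hL, hR, ← mul_add]
  have h1 : 1 / Z ≤ 16 / N ^ 3 := by
    rw [div_le_div_iff₀ hZpos (by positivity)]; linarith
  have h2 : 1 / Z * (∫ t in (-1:ℝ)..0, -t * K.eval t) + 1 / Z * (∫ t in (0:ℝ)..1, t * K.eval t)
      ≤ 1 / Z * (2 * N ^ 2) + 1 / Z * (2 * N ^ 2) := by gcongr
  have h3 : 1 / Z * (2 * N ^ 2 + 2 * N ^ 2) ≤ 16 / N ^ 3 * (2 * N ^ 2 + 2 * N ^ 2) := by gcongr
  have h4 : 16 / N ^ 3 * (2 * N ^ 2 + 2 * N ^ 2) = 64 / N := by field_simp; norm_num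
  have h5 : 64 / N ≤ 64 / m := by
    gcongr; linarith
  linarith

lemma lint_transl_le (F : ℝ → ℝ≥0∞) (A B : Set ℝ) (hA : MeasurableSet A) (hB : MeasurableSet B)
    (y : ℝ) (h : ∀ t ∈ A, t - y ∈ B) :
    ∫⁻ t in A, F (t - y) ≤ ∫⁻ t in B, F t := by
  rw [← lintegral_indicator hA, ← lintegral_indicator hB,
    ← lintegral_sub_right_eq_self (μ := volume) (B.indicator F) y]
  refine lintegral_mono fun t => ?_
  by_cases ht : t ∈ A
  · simp [ht, h t ht]
  · simp [ht]

lemma lint_transl_le' (F : ℝ → ℝ≥0∞) (A B : Set ℝ) (hA : MeasurableSet A) (hB : MeasurableSet B)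
    (x : ℝ) (h : ∀ t ∈ A, x - t ∈ B) :
    ∫⁻ t in A, F (x - t) ≤ ∫⁻ t in B, F t := by
  rw [← lintegral_indicator hA, ← lintegral_indicator hB,
    ← lintegral_sub_left_eq_self (μ := volume) (B.indicator F) x]
  refine lintegral_mono fun t => ?_
  by_cases ht : t ∈ A
  · simp [ht, h t ht]
  · simp [ht]

lemma poly_eval_sub (p : Polynomial ℝ) (n : ℕ) (hp : p.natDegree ≤ n) (t y : ℝ) :
    p.eval (t - y) = ∑ l ∈ Finset.range (n + 1),
      t ^ l * (Polynomial.hasseDeriv l p).eval (-y) := by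
  have h : p.eval (t - y) = (Polynomial.taylor (-y) p).eval t := by
    rw [Polynomial.taylor_eval, sub_eq_add_neg]
  rw [h, Polynomial.eval_eq_sum_range' (n := n + 1)]
  · refine Finset.sum_congr rfl fun l _ => ?_
    rw [Polynomial.taylor_coeff, mul_comm]
  · rw [Polynomial.natDegree_taylor]; omega

lemma conv_poly (p : Polynomial ℝ) (n : ℕ) (hp : p.natDegree ≤ n) (e : ℝ → ℝ) (a b : ℝ)
    (he : IntervalIntegrable e volume a b) : ∃ q : Polynomial ℝ, q.natDegree ≤ n ∧
      ∀ t, q.eval t = ∫ y in a..b, p.eval (t - y) * e y := by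
  refine ⟨∑ l ∈ Finset.range (n + 1),
    Polynomial.C (∫ y in a..b, (Polynomial.hasseDeriv l p).eval (-y) * e y) * Polynomial.X ^ l,
    ?_, ?_⟩
  · refine Polynomial.natDegree_sum_le_of_forall_le _ _ fun l hl => ?_
    refine (Polynomial.natDegree_C_mul_X_pow_le _ _).trans ?_
    have := Finset.mem_range.1 hl
    omega
  · intro t
    simp only [poly_eval_sub p n hp t, Finset.sum_mul, Polynomial.eval_finsetSum]
    rw [intervalIntegral.integral_finsetSum]
    · refine Finset.sum_congr rfl fun l _ => ?_
      simp only [Polynomial.eval_mul, Polynomial.eval_C, Polynomial.eval_pow, Polynomial.eval_X]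
      rw [mul_comm, ← intervalIntegral.integral_const_mul]
      congr 1; ext y; ring
    · intro l _
      refine he.continuousOn_mul (Continuous.continuousOn ?_)
      have := (Polynomial.hasseDeriv l p).continuous
      fun_prop

lemma heaviside_approx4 (m : ℕ) (hm : 1 ≤ m) : ∃ P : Polynomial ℝ, P.natDegree ≤ 9 * m ∧
    ∫⁻ t in Set.Icc (-4 : ℝ) 4, ‖tpow 0 t - P.eval t‖ₑ ≤ ENNReal.ofReal (256 / m) := by
  obtain ⟨P, hP, hP'⟩ := heaviside_approx m hm
  refine ⟨P.comp (Polynomial.C (1 / 4) * Polynomial.X), ?_, ?_⟩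
  · refine Polynomial.natDegree_comp_le.trans ?_
    have h1 : (Polynomial.C (1 / 4 : ℝ) * Polynomial.X).natDegree ≤ 1 := by
      compute_degree
    calc _ ≤ P.natDegree * 1 := Nat.mul_le_mul_left _ h1
      _ ≤ _ := by omega
  · rw [intervalIntegral_eq_lintegral (fun t => tpow 0 t -
        (P.comp (Polynomial.C (1 / 4) * Polynomial.X)).eval t) (by norm_num)
        ((tpow_int 0 _ _).sub ((Polynomial.continuous _).intervalIntegrable _ _))]
    apply ENNReal.ofReal_le_ofReal
    have h := intervalIntegral.integral_comp_mul_left (a := -4) (b := 4) (c := 1 / 4)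
      (fun t => |tpow 0 t - P.eval t|) (by norm_num)
    have e1 : (1 / 4 : ℝ) * -4 = -1 := by norm_num
    have e2 : (1 / 4 : ℝ) * 4 = 1 := by norm_num
    rw [e1, e2] at h
    have h2 : ∀ t, tpow 0 (1 / 4 * t) = tpow 0 t := by
      intro t
      unfold tpow
      have : (0 < 1 / 4 * t) ↔ 0 < t := by constructor <;> intro h <;> linarith
      simp only [this, pow_zero]
    simp only [h2] at h
    simp only [Polynomial.eval_comp, Polynomial.eval_mul, Polynomial.eval_C, Polynomial.eval_X]
    rw [h, smul_eq_mul]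
    have : (256 : ℝ) / m = (1 / 4)⁻¹ * (64 / m) := by norm_num; ring
    rw [this]
    gcongr

lemma tpow_conv (e : ℝ → ℝ) (a b t : ℝ)
    (ht : t ∈ Set.Icc a b) :
    ∫ y in a..b, tpow 0 (t - y) * e y = ∫ y in a..t, e y := by
  have hab' : a ≤ b := ht.1.trans ht.2
  rw [intervalIntegral.integral_of_le hab', intervalIntegral.integral_of_le ht.1,
    integral_Ioc_eq_integral_Ioo (y := t), ← integral_indicator measurableSet_Ioc,
    ← integral_indicator measurableSet_Ioo]
  congr 1
  ext y
  by_cases h1 : y ∈ Set.Ioo a t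
  · have h2 : y ∈ Set.Ioc a b := ⟨h1.1, h1.2.le.trans ht.2⟩
    have : 0 < t - y := by linarith [h1.2]
    rw [Set.indicator_of_mem h1, Set.indicator_of_mem h2, tpow, if_pos this, pow_zero, one_mul]
  · rw [Set.indicator_of_notMem h1]
    by_cases h2 : y ∈ Set.Ioc a b
    · have : ¬ (0 < t - y) := fun h => h1 ⟨h2.1, by linarith⟩
      rw [Set.indicator_of_mem h2, tpow, if_neg this, zero_mul]
    · rw [Set.indicator_of_notMem h2]

lemma tpow_approx (s : ℕ) : ∃ (C : ℝ) (L : ℕ), 0 < C ∧ ∀ m : ℕ, 1 ≤ m → ∃ P : Polynomial ℝ,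
    P.natDegree ≤ L * m ∧
    ∫⁻ t in Set.Icc (-2 : ℝ) 2, ‖tpow s t - P.eval t‖ₑ ≤ ENNReal.ofReal (C / m ^ (s + 1)) := by
  induction s with
  | zero =>
    refine ⟨256, 9, by norm_num, fun m hm => ?_⟩
    obtain ⟨P, hP, hP'⟩ := heaviside_approx4 m hm
    refine ⟨P, hP, ?_⟩
    simp only [zero_add, pow_one]
    refine le_trans (lintegral_mono_set ?_) hP'
    exact Set.Icc_subset_Icc (by norm_num) (by norm_num)
  | succ s ih =>
    obtain ⟨C, L, hC, ih⟩ := ih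
    refine ⟨(s + 1) * (C * 256), L + 9 + 1, by positivity, fun m hm => ?_⟩
    obtain ⟨p, hp, hp'⟩ := ih m hm
    obtain ⟨η, hη, hη'⟩ := heaviside_approx4 m hm
    obtain ⟨A, hA, hA'⟩ := exists_antideriv p
    have hpi : ∀ a b, IntervalIntegrable (fun t => p.eval t) volume a b := fun a b =>
      (Polynomial.continuous _).intervalIntegrable _ _
    have hei : ∀ a b, IntervalIntegrable (fun t => tpow s t - p.eval t) volume a b := fun a b =>
      (tpow_int s a b).sub (hpi a b)
    obtain ⟨q, hq, hq'⟩ := conv_poly η (9 * m) hη (fun t => tpow s t - p.eval t) (-2) 2 (hei _ _)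
    have hmeas1 : Measurable (fun t => tpow 0 t - η.eval t) :=
      (tpow_meas 0).sub (Polynomial.continuous _).measurable
    have hmeas2 : Measurable (fun t => tpow s t - p.eval t) :=
      (tpow_meas s).sub (Polynomial.continuous _).measurable
    refine ⟨Polynomial.C ((s : ℝ) + 1) * (A - Polynomial.C (A.eval (-2)) + q), ?_, ?_⟩
    · refine (Polynomial.natDegree_C_mul_le _ _).trans ?_
      refine (Polynomial.natDegree_add_le _ _).trans (max_le ?_ ?_)
      · rw [Polynomial.natDegree_sub_C]
        nlinarith
      · nlinarith
    · have key : ∀ t ∈ Set.Icc (-2 : ℝ) 2, tpow (s + 1) t -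
          (Polynomial.C ((s : ℝ) + 1) * (A - Polynomial.C (A.eval (-2)) + q)).eval t =
          (s + 1) * ∫ y in (-2 : ℝ)..2, (tpow 0 (t - y) - η.eval (t - y)) *
            (tpow s y - p.eval y) := by
        intro t ht
        have i1 : IntervalIntegrable (fun y => tpow 0 (t - y) * (tpow s y - p.eval y))
            volume (-2) 2 := by
          refine IntervalIntegrable.mono_fun' (hei (-2) 2).abs
            (Measurable.aestronglyMeasurable ?_) ?_
          · exact ((tpow_meas 0).comp (measurable_const.sub measurable_id)).mul hmeas2
          · refine Filter.Eventually.of_forall fun y => ?_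
            have : |tpow 0 (t - y)| ≤ 1 := by unfold tpow; split_ifs <;> simp
            simp only [Real.norm_eq_abs, abs_mul]
            exact mul_le_of_le_one_left (abs_nonneg _) this
        have i2 : IntervalIntegrable (fun y => η.eval (t - y) * (tpow s y - p.eval y))
            volume (-2) 2 := by
          refine (hei _ _).continuousOn_mul (Continuous.continuousOn ?_)
          have := η.continuous
          fun_prop
        have h1 := tpow_conv (fun y => tpow s y - p.eval y) (-2) 2 t ht
        rw [intervalIntegral.integral_sub (tpow_int s _ _) (hpi _ _),
          integral_tpow s _ _ (by norm_num), integral_poly_deriv A p hA'] at h1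
        have h2 : ∫ y in (-2 : ℝ)..2, (tpow 0 (t - y) - η.eval (t - y)) *
            (tpow s y - p.eval y) = (∫ y in (-2 : ℝ)..2, tpow 0 (t - y) * (tpow s y - p.eval y))
            - ∫ y in (-2 : ℝ)..2, η.eval (t - y) * (tpow s y - p.eval y) := by
          rw [← intervalIntegral.integral_sub i1 i2]
          congr 1; ext y; ring
        rw [h2, h1, ← hq' t]
        simp only [Polynomial.eval_mul, Polynomial.eval_C, Polynomial.eval_add,
          Polynomial.eval_sub]
        have : (s : ℝ) + 1 ≠ 0 := by positivity
        field_simp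
        ring
      calc _ = ∫⁻ t in Set.Icc (-2 : ℝ) 2, ‖(s + 1) * ∫ y in (-2 : ℝ)..2,
            (tpow 0 (t - y) - η.eval (t - y)) * (tpow s y - p.eval y)‖ₑ :=
            setLIntegral_congr_fun measurableSet_Icc fun t ht => by rw [key t ht]
        _ ≤ ∫⁻ t in Set.Icc (-2 : ℝ) 2, ENNReal.ofReal (s + 1) * ∫⁻ y in Set.Icc (-2 : ℝ) 2,
            ‖tpow 0 (t - y) - η.eval (t - y)‖ₑ * ‖tpow s y - p.eval y‖ₑ := by
            refine lintegral_mono fun t => ?_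
            rw [enorm_mul, Real.enorm_of_nonneg (by positivity)]
            gcongr
            refine (enorm_intervalIntegral_le _ (by norm_num)).trans ?_
            simp only [enorm_mul, le_refl]
        _ = ENNReal.ofReal (s + 1) * ∫⁻ y in Set.Icc (-2 : ℝ) 2, ∫⁻ t in Set.Icc (-2 : ℝ) 2,
            ‖tpow 0 (t - y) - η.eval (t - y)‖ₑ * ‖tpow s y - p.eval y‖ₑ := by
            rw [lintegral_const_mul' _ _ ENNReal.ofReal_ne_top, lintegral_lintegral_swap]
            refine Measurable.aemeasurable ?_
            exact ((hmeas1.comp (measurable_fst.sub measurable_snd)).enorm).mul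
              (hmeas2.comp measurable_snd).enorm
        _ ≤ ENNReal.ofReal (s + 1) * ∫⁻ y in Set.Icc (-2 : ℝ) 2,
            ENNReal.ofReal (256 / m) * ‖tpow s y - p.eval y‖ₑ := by
            gcongr ENNReal.ofReal (s + 1) * ?_
            refine setLIntegral_mono' measurableSet_Icc fun y hy => ?_
            rw [lintegral_mul_const' _ _ enorm_ne_top]
            gcongr
            refine le_trans (lint_transl_le (fun t => ‖tpow 0 t - η.eval t‖ₑ) _ (Set.Icc (-4) 4)
              measurableSet_Icc measurableSet_Icc y ?_) hη'
            intro t ht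
            exact ⟨by linarith [ht.1, hy.2], by linarith [ht.2, hy.1]⟩
        _ ≤ ENNReal.ofReal (s + 1) * (ENNReal.ofReal (256 / m) *
              ENNReal.ofReal (C / m ^ (s + 1))) := by
            rw [lintegral_const_mul' _ _ ENNReal.ofReal_ne_top]
            gcongr
        _ = _ := by
            rw [← ENNReal.ofReal_mul (by positivity), ← ENNReal.ofReal_mul (by positivity)]
            congr 1
            have : (m : ℝ) ≠ 0 := by positivity
            field_simp
            ring

/-- Lebesgue measure on the interval -/
noncomputable def muI : Measure ℝ := volume.restrict (Set.Icc (-1 : ℝ) 1)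

lemma muI_univ : muI Set.univ = 2 := by
  simp [muI]; norm_num

instance : IsFiniteMeasure muI := ⟨by rw [muI_univ]; simp⟩

lemma enorm_le_top_norm {X : Type*} [TopologicalSpace X] [MeasurableSpace X] [OpensMeasurableSpace X]
    (μ : Measure X) [μ.IsOpenPosMeasure] (s : Set X) (hs : s ⊆ closure (interior s))
    (g : X → ℝ) (hg : ContinuousOn g s) : ∀ x ∈ s, ‖g x‖ₑ ≤ eLpNorm g ∞ (μ.restrict s) := by
  intro x hx
  set M := eLpNorm g ∞ (μ.restrict s) with hM
  have h1 : (fun x => max ‖g x‖ₑ M) =ᵐ[μ.restrict s] fun _ => M := by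
    filter_upwards [enorm_ae_le_eLpNormEssSup g (μ.restrict s)] with y hy
    rw [max_eq_right]
    rw [hM, eLpNorm_exponent_top]
    exact hy
  have hc : ContinuousOn (fun x => ‖g x‖ₑ) s := continuous_enorm.comp_continuousOn hg
  have h2 := Measure.eqOn_of_ae_eq h1 (hc.sup continuousOn_const) continuousOn_const hs hx
  simp only at h2
  rw [← h2]
  exact le_max_left _ _

lemma Icc_sub_closure : Set.Icc (-1 : ℝ) 1 ⊆ closure (interior (Set.Icc (-1 : ℝ) 1)) := by
  rw [interior_Icc, closure_Ioo (by norm_num)]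

lemma enorm_le_top_I (g : ℝ → ℝ) (hg : ContinuousOn g (Set.Icc (-1) 1)) :
    ∀ x ∈ Set.Icc (-1 : ℝ) 1, ‖g x‖ₑ ≤ eLpNorm g ∞ muI :=
  enorm_le_top_norm volume _ Icc_sub_closure g hg

lemma jensen_enn {U : Type*} [MeasurableSpace U] (ν : Measure U) (k : U → ℝ≥0∞) (f : U → ℝ)
    (hk : Measurable k) (hf : Measurable f) (p : ℝ) (hp : 1 ≤ p) :
    (∫⁻ u, k u * ‖f u‖ₑ ∂ν) ^ p ≤ (∫⁻ u, k u ∂ν) ^ (p - 1) * ∫⁻ u, k u * ‖f u‖ₑ ^ p ∂ν := by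
  have hp0 : 0 < p := by linarith
  set l := ν.withDensity k with hl
  have e1 : ∫⁻ u, k u * ‖f u‖ₑ ∂ν = eLpNorm f 1 l := by
    rw [eLpNorm_one_eq_lintegral_enorm, hl, lintegral_withDensity_eq_lintegral_mul _ hk hf.enorm]
    rfl
  have e2 : ∫⁻ u, k u * ‖f u‖ₑ ^ p ∂ν = ∫⁻ u, ‖f u‖ₑ ^ p ∂l := by
    rw [hl, lintegral_withDensity_eq_lintegral_mul _ hk (hf.enorm.pow_const p)]
    rfl
  have e3 : ∫⁻ u, k u ∂ν = l Set.univ := by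
    rw [hl, withDensity_apply _ MeasurableSet.univ, Measure.restrict_univ]
  have h1 : (1 : ℝ≥0∞) ≤ ENNReal.ofReal p := by
    rw [← ENNReal.ofReal_one]; exact ENNReal.ofReal_le_ofReal hp
  have h := eLpNorm_le_eLpNorm_mul_rpow_measure_univ (μ := l) h1 hf.aestronglyMeasurable
  rw [eLpNorm_eq_lintegral_rpow_enorm_toReal (p := ENNReal.ofReal p) (by simpa using hp0) (by simp),
    ENNReal.toReal_ofReal hp0.le] at h
  rw [e1, e2, e3]
  calc _ ≤ ((∫⁻ u, ‖f u‖ₑ ^ p ∂l) ^ (1 / p) * l Set.univ ^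
        (1 / ENNReal.toReal 1 - 1 / p)) ^ p := by gcongr
    _ = _ := by
      rw [ENNReal.mul_rpow_of_nonneg _ _ hp0.le, ← ENNReal.rpow_mul, ← ENNReal.rpow_mul, mul_comm]
      congr 1
      · congr 1; simp; field_simp
      · rw [one_div_mul_cancel hp0.ne', ENNReal.rpow_one]

lemma schur_gen {U : Type*} [MeasurableSpace U] (ν : Measure U) (κ : ℝ → U → ℝ≥0∞)
    (τ : ℝ → U → ℝ) (g h : ℝ → ℝ) (C : ℝ≥0∞) (hC : C ≠ ∞) (hg : Continuous g)
    (hκ : ∀ x ∈ Set.Icc (-1 : ℝ) 1, Measurable (κ x))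
    (hτ : ∀ x ∈ Set.Icc (-1 : ℝ) 1, Measurable (τ x))
    (hτI : ∀ x ∈ Set.Icc (-1 : ℝ) 1, ∀ᵐ u ∂ν, τ x u ∈ Set.Icc (-1 : ℝ) 1)
    (h1 : ∀ x ∈ Set.Icc (-1 : ℝ) 1, ∫⁻ u, κ x u ∂ν ≤ C)
    (h2 : ∀ G : ℝ → ℝ≥0∞, Measurable G →
      ∫⁻ x, ∫⁻ u, κ x u * G (τ x u) ∂ν ∂muI ≤ C * ∫⁻ x, G x ∂muI)
    (hh : ∀ x ∈ Set.Icc (-1 : ℝ) 1, ‖h x‖ₑ ≤ ∫⁻ u, κ x u * ‖g (τ x u)‖ₑ ∂ν)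
    (p : ℝ≥0∞) (hp : 1 ≤ p) : eLpNorm h p muI ≤ C * eLpNorm g p muI := by
  rcases eq_or_ne p ∞ with rfl | hpt
  · rw [eLpNorm_exponent_top (f := h)]
    refine eLpNormEssSup_le_of_ae_enorm_bound ?_
    refine (ae_restrict_iff' measurableSet_Icc).2 (Filter.Eventually.of_forall fun x hx => ?_)
    refine (hh x hx).trans ?_
    calc _ ≤ ∫⁻ u, κ x u * eLpNorm g ∞ muI ∂ν := by
          refine lintegral_mono_ae ?_
          filter_upwards [hτI x hx] with u hu
          gcongr
          exact enorm_le_top_I g hg.continuousOn _ hu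
      _ = (∫⁻ u, κ x u ∂ν) * eLpNorm g ∞ muI := lintegral_mul_const _ (hκ x hx)
      _ ≤ _ := by gcongr; exact h1 x hx
  · have hp0 : p ≠ 0 := (zero_lt_one.trans_le hp).ne'
    have hq : 1 ≤ p.toReal := by
      rw [← ENNReal.toReal_one]; exact ENNReal.toReal_mono hpt hp
    set q := p.toReal
    have hq0 : 0 < q := by linarith
    rw [eLpNorm_eq_lintegral_rpow_enorm_toReal hp0 hpt,
      eLpNorm_eq_lintegral_rpow_enorm_toReal hp0 hpt]
    have hmain : ∫⁻ x, ‖h x‖ₑ ^ q ∂muI ≤ C ^ q * ∫⁻ x, ‖g x‖ₑ ^ q ∂muI := by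
      calc _ ≤ ∫⁻ x, C ^ (q - 1) * ∫⁻ u, κ x u * ‖g (τ x u)‖ₑ ^ q ∂ν ∂muI := by
            refine setLIntegral_mono' measurableSet_Icc fun x hx => ?_
            calc _ ≤ (∫⁻ u, κ x u * ‖g (τ x u)‖ₑ ∂ν) ^ q := by
                  gcongr; exact hh x hx
              _ ≤ _ := jensen_enn ν (κ x) (fun u => g (τ x u)) (hκ x hx)
                  (hg.measurable.comp (hτ x hx)) q hq
              _ ≤ _ := by
                  gcongr
                  exact h1 x hx
        _ = C ^ (q - 1) * ∫⁻ x, ∫⁻ u, κ x u * ‖g (τ x u)‖ₑ ^ q ∂ν ∂muI := by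
            rw [lintegral_const_mul']
            exact ENNReal.rpow_ne_top_of_nonneg (by linarith) hC
        _ ≤ C ^ (q - 1) * (C * ∫⁻ x, ‖g x‖ₑ ^ q ∂muI) := by
            gcongr
            exact h2 (fun y => ‖g y‖ₑ ^ q) (hg.measurable.enorm.pow_const q)
        _ = _ := by
            rw [← mul_assoc]
            congr 1
            rcases eq_or_ne C 0 with rfl | h0
            · rw [ENNReal.zero_rpow_of_pos hq0, mul_zero]
            · nth_rewrite 2 [← ENNReal.rpow_one C]
              rw [← ENNReal.rpow_add _ _ h0 hC]
              congr 1; ring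
    calc _ ≤ (C ^ q * ∫⁻ x, ‖g x‖ₑ ^ q ∂muI) ^ (1 / q) := by gcongr
      _ = _ := by
        rw [ENNReal.mul_rpow_of_nonneg _ _ (by positivity), ← ENNReal.rpow_mul,
          mul_one_div_cancel hq0.ne', ENNReal.rpow_one]

lemma schur_kernel (κ : ℝ → ℝ → ℝ≥0∞) (g h : ℝ → ℝ) (C : ℝ≥0∞) (hC : C ≠ ∞) (hg : Continuous g)
    (hκ : Measurable (Function.uncurry κ))
    (h1 : ∀ x ∈ Set.Icc (-1 : ℝ) 1, ∫⁻ y, κ x y ∂muI ≤ C)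
    (h2 : ∀ y ∈ Set.Icc (-1 : ℝ) 1, ∫⁻ x, κ x y ∂muI ≤ C)
    (hh : ∀ x ∈ Set.Icc (-1 : ℝ) 1, ‖h x‖ₑ ≤ ∫⁻ y, κ x y * ‖g y‖ₑ ∂muI)
    (p : ℝ≥0∞) (hp : 1 ≤ p) : eLpNorm h p muI ≤ C * eLpNorm g p muI := by
  refine schur_gen muI κ (fun _ y => y) g h C hC hg (fun x _ => hκ.of_uncurry_left)
    (fun _ _ => measurable_id) (fun x _ => ae_restrict_mem measurableSet_Icc) h1 ?_ hh p hp
  intro G hG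
  rw [lintegral_lintegral_swap]
  · rw [← lintegral_const_mul' _ _ hC]
    refine setLIntegral_mono' measurableSet_Icc fun y hy => ?_
    rw [lintegral_mul_const _ (hκ.of_uncurry_right)]
    gcongr
    exact h2 y hy
  · exact (hκ.mul (hG.comp measurable_snd)).aemeasurable

lemma lint_affine (G : ℝ → ℝ≥0∞) (hG : Measurable G) (a b : ℝ) (ha : 0 < a)
    (hab : ∀ x ∈ Set.Icc (-1 : ℝ) 1, a * x + b ∈ Set.Icc (-1 : ℝ) 1) :
    ∫⁻ x, G (a * x + b) ∂muI ≤ ENNReal.ofReal (1 / a) * ∫⁻ x, G x ∂muI := by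
  unfold muI
  rw [← lintegral_indicator measurableSet_Icc, ← lintegral_indicator measurableSet_Icc]
  set H := (Set.Icc (-1 : ℝ) 1).indicator G with hH
  have hHm : Measurable H := hG.indicator measurableSet_Icc
  calc _ ≤ ∫⁻ x, H (a * x + b) := by
        refine lintegral_mono fun x => ?_
        by_cases hx : x ∈ Set.Icc (-1 : ℝ) 1
        · rw [Set.indicator_of_mem hx, hH, Set.indicator_of_mem (hab x hx)]
        · rw [Set.indicator_of_notMem hx]; exact zero_le
    _ = ∫⁻ x, H (x + b) ∂(Measure.map (fun x => a * x) volume) := by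
        have hm : Measurable fun x => H (x + b) := hHm.comp (measurable_id.add_const b)
        rw [lintegral_map hm (measurable_const_mul a)]
    _ = _ := by
        rw [Real.map_volume_mul_left ha.ne', lintegral_smul_measure,
          lintegral_add_right_eq_self H b, abs_of_pos (by positivity), smul_eq_mul, one_div]

lemma avg_bound (g h : ℝ → ℝ) (hg : Continuous g) (B : ℝ) (hB : 0 ≤ B) (a : ℝ) (ha0 : 0 ≤ a) (ha : a ≤ 1 / 2)
    (hh : ∀ x ∈ Set.Icc (-1 : ℝ) 1, ‖h x‖ₑ ≤ ENNReal.ofReal B *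
      ∫⁻ u, (∫⁻ s in Set.Icc (0 : ℝ) 1, ‖g ((1 - s * a) * x + s * a * u)‖ₑ) ∂muI)
    (p : ℝ≥0∞) (hp : 1 ≤ p) : eLpNorm h p muI ≤ ENNReal.ofReal (4 * B) * eLpNorm g p muI := by
  set ν := muI.prod (volume.restrict (Set.Icc (0 : ℝ) 1)) with hν
  have hmem : ∀ᵐ z ∂ν, z.1 ∈ Set.Icc (-1 : ℝ) 1 ∧ z.2 ∈ Set.Icc (0 : ℝ) 1 := by
    rw [hν, muI, Measure.prod_restrict]
    filter_upwards [ae_restrict_mem (measurableSet_Icc.prod measurableSet_Icc)] with z hz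
    exact hz
  have hconv : ∀ u s, u ∈ Set.Icc (-1 : ℝ) 1 → s ∈ Set.Icc (0 : ℝ) 1 → ∀ x ∈ Set.Icc (-1 : ℝ) 1,
      (1 - s * a) * x + s * a * u ∈ Set.Icc (-1 : ℝ) 1 := by
    intro u s hu hs x hx
    have h1 : 0 ≤ s * a := mul_nonneg hs.1 ha0
    have h2 : s * a ≤ 1 := by nlinarith [hs.2]
    have := (convex_Icc (-1 : ℝ) 1) hx hu (sub_nonneg.2 h2) h1 (by ring)
    simpa [smul_eq_mul] using this
  refine schur_gen ν (fun _ _ => ENNReal.ofReal B) (fun x z => (1 - z.2 * a) * x + z.2 * a * z.1) g h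
    (ENNReal.ofReal (4 * B)) ENNReal.ofReal_ne_top hg (fun _ _ => measurable_const)
    (fun x _ => by fun_prop) ?_ ?_ ?_ ?_ p hp
  · intro x hx
    filter_upwards [hmem] with z hz
    exact hconv _ _ hz.1 hz.2 x hx
  · intro x _
    rw [lintegral_const, hν, ← Set.univ_prod_univ, Measure.prod_prod, muI_univ]
    simp only [MeasurableSet.univ, Measure.restrict_apply, Set.univ_inter, Real.volume_Icc,
      sub_zero, ENNReal.ofReal_one, mul_one]
    rw [mul_comm (4 : ℝ), ENNReal.ofReal_mul hB]
    gcongr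
    simp; norm_num
  · intro G hG
    rw [lintegral_lintegral_swap]
    · calc _ ≤ ∫⁻ z, ENNReal.ofReal B * (ENNReal.ofReal 2 * ∫⁻ x, G x ∂muI) ∂ν := by
            refine lintegral_mono_ae ?_
            filter_upwards [hmem] with z hz
            rw [lintegral_const_mul' _ _ ENNReal.ofReal_ne_top]
            gcongr
            have h1 : 0 ≤ z.2 * a := mul_nonneg hz.2.1 ha0
            have h2 : z.2 * a ≤ 1 / 2 := by nlinarith [hz.2.2]
            refine (lint_affine G hG (1 - z.2 * a) (z.2 * a * z.1) (by linarith)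
              (fun x hx => hconv _ _ hz.1 hz.2 x hx)).trans ?_
            gcongr
            rw [div_le_iff₀ (by linarith)]
            linarith
        _ = _ := by
            rw [lintegral_const, hν, ← Set.univ_prod_univ, Measure.prod_prod, muI_univ]
            simp only [MeasurableSet.univ, Measure.restrict_apply, Set.univ_inter, Real.volume_Icc,
              sub_zero, ENNReal.ofReal_one, mul_one]
            rw [ENNReal.ofReal_mul (by norm_num : (0 : ℝ) ≤ 4)]
            have : ENNReal.ofReal 4 = ENNReal.ofReal 2 * 2 := by
              rw [← ENNReal.ofReal_ofNat 2, ← ENNReal.ofReal_mul (by norm_num)]; norm_num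
            rw [this]; ring
    · refine Measurable.aemeasurable ?_
      refine measurable_const.mul (hG.comp ?_)
      fun_prop
  · intro x hx
    refine (hh x hx).trans ?_
    rw [lintegral_const_mul' _ _ ENNReal.ofReal_ne_top]
    gcongr
    rw [hν, lintegral_prod]
    have hm : Measurable (fun z : ℝ × ℝ => (1 - z.2 * a) * x + z.2 * a * z.1) := by fun_prop
    exact (hg.measurable.comp hm).enorm.aemeasurable

lemma exists_bump : ∃ (w : ℕ → ℝ → ℝ) (B : ℕ → ℝ), (∀ j, Continuous (w j)) ∧
    (∀ j x, HasDerivAt (w j) (w (j + 1) x) x) ∧ (∀ j x, 1 ≤ |x| → w j x = 0) ∧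
    (∫ u in (-1 : ℝ)..1, w 0 u = 1) ∧ (∀ j x, |w j x| ≤ B j) ∧ ∀ j, 0 < B j := by
  let f : ContDiffBump (0 : ℝ) := ⟨1 / 4, 1 / 2, by norm_num, by norm_num⟩
  have hsm : ContDiff ℝ (⊤ : ℕ∞) (f.normed volume) := f.contDiff_normed
  have hcont : ∀ j, Continuous (iteratedDeriv j (f.normed volume)) := fun j =>
    hsm.continuous_iteratedDeriv j (by exact_mod_cast le_top)
  have hder : ∀ j x, HasDerivAt (iteratedDeriv j (f.normed volume))
      (iteratedDeriv (j + 1) (f.normed volume) x) x := by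
    intro j x
    rw [iteratedDeriv_succ]
    exact (hsm.differentiable_iteratedDeriv j (by exact_mod_cast WithTop.coe_lt_top j) x).hasDerivAt
  have h0 : ∀ x : ℝ, 1 / 2 < |x| → f.normed volume x = 0 := by
    intro x hx
    by_contra h
    have : x ∈ Function.support (f.normed volume) := h
    rw [f.support_normed_eq] at this
    simp [f] at this
    norm_num at hx
    linarith
  have hz : ∀ j, ∀ x : ℝ, 1 / 2 < |x| → iteratedDeriv j (f.normed volume) x = 0 := by
    intro j
    induction j with
    | zero => simpa using h0
    | succ j ih =>
      intro x hx
      rw [iteratedDeriv_succ]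
      have : iteratedDeriv j (f.normed volume) =ᶠ[nhds x] fun _ => 0 := by
        filter_upwards [(isOpen_lt continuous_const continuous_abs).mem_nhds hx] with y hy
        exact ih y hy
      rw [this.deriv_eq]; simp
  have hb : ∀ j, ∃ B : ℝ, 0 < B ∧ ∀ x, |iteratedDeriv j (f.normed volume) x| ≤ B := by
    intro j
    obtain ⟨B, hB⟩ := (isCompact_Icc (a := (-1 : ℝ)) (b := 1)).exists_bound_of_continuousOn
      (hcont j).continuousOn
    refine ⟨max B 1, by positivity, fun x => ?_⟩
    by_cases hx : x ∈ Set.Icc (-1 : ℝ) 1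
    · exact (hB x hx).trans (le_max_left _ _)
    · rw [hz j x, abs_zero]
      · positivity
      · by_contra h
        push Not at h
        have := abs_le.1 h
        exact hx ⟨by linarith, by linarith⟩
  choose B hB0 hB using hb
  refine ⟨fun j => iteratedDeriv j (f.normed volume), B, hcont, hder,
    fun j x hx => hz j x (by linarith), ?_, hB, hB0⟩
  rw [intervalIntegral.integral_eq_integral_of_support_subset]
  · simpa using f.integral_normed (μ := volume)
  · intro x hx
    by_contra h
    refine hx (hz 0 x ?_)
    by_contra h'
    push Not at h'
    have := abs_le.1 h'
    exact h ⟨by linarith, by linarith⟩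

/-- a chain of successive derivatives on the interval -/
def IsCh (r : ℕ) (g : ℕ → ℝ → ℝ) : Prop := (∀ j ≤ r, Continuous (g j)) ∧
  ∀ j < r, ∀ x ∈ Set.Ioo (-1 : ℝ) 1, HasDerivAt (g j) (g (j + 1) x) x

lemma uIcc_sub_I {c x : ℝ} (hc : c ∈ Set.Icc (-1 : ℝ) 1) (hx : x ∈ Set.Icc (-1 : ℝ) 1) :
    Set.Ioo (min c x) (max c x) ⊆ Set.Ioo (-1 : ℝ) 1 := by
  refine Set.Ioo_subset_Ioo (le_min hc.1 hx.1) (max_le hc.2 hx.2)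

lemma chain_taylor (r : ℕ) (g : ℕ → ℝ → ℝ) (h : IsCh (r + 1) g) (c x : ℝ)
    (hc : c ∈ Set.Icc (-1 : ℝ) 1) (hx : x ∈ Set.Icc (-1 : ℝ) 1) :
    g 0 x = ∑ j ∈ Finset.range (r + 1), g j c * ((x - c) ^ j / j.factorial) +
      ∫ y in c..x, (x - y) ^ r / r.factorial * g (r + 1) y := by
  induction r with
  | zero =>
    have := intervalIntegral.integral_eq_sub_of_hasDeriv_right (a := c) (b := x)
      (h.1 0 (by norm_num)).continuousOn
      (fun y hy => (h.2 0 (by norm_num) y (uIcc_sub_I hc hx hy)).hasDerivWithinAt)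
      ((h.1 1 le_rfl).intervalIntegrable _ _)
    simp [this]
  | succ r ih =>
    rw [ih ⟨fun j hj => h.1 j (by omega), fun j hj => h.2 j (by omega)⟩,
      Finset.sum_range_succ _ (r + 1), add_assoc]
    congr 1
    have := intervalIntegral.integral_mul_deriv_eq_deriv_mul_of_hasDeriv_right (a := c) (b := x)
      (u := fun y => (x - y) ^ (r + 1) / (r + 1).factorial) (v := g (r + 1))
      (u' := fun y => - ((x - y) ^ r / r.factorial)) (v' := g (r + 2))
      (by fun_prop) (h.1 (r + 1) (by omega)).continuousOn
      (fun y hy => ?_)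
      (fun y hy => (h.2 (r + 1) (by omega) y (uIcc_sub_I hc hx hy)).hasDerivWithinAt)
      (Continuous.intervalIntegrable (by fun_prop) _ _)
      ((h.1 (r + 2) le_rfl).intervalIntegrable _ _)
    · rw [this]
      simp only [sub_self, neg_mul, intervalIntegral.integral_neg]
      simp
      ring
    · have h1 : HasDerivAt (fun y => (x - y) ^ (r + 1) / ((r + 1).factorial : ℝ))
        (((r + 1 : ℕ) * (x - y) ^ r * (-1)) / ((r + 1).factorial : ℝ)) y := by
        have := (((hasDerivAt_id y).const_sub x).pow (r + 1)).div_const ((r + 1).factorial : ℝ)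
        simpa using this
      refine (h1.congr_deriv ?_).hasDerivWithinAt
      rw [Nat.factorial_succ]
      push_cast
      field_simp

lemma chain_taylor_bd (r : ℕ) (g : ℕ → ℝ → ℝ) (h : IsCh (r + 1) g) (x k : ℝ)
    (hx : x ∈ Set.Icc (-1 : ℝ) 1) (hk : x + k ∈ Set.Icc (-1 : ℝ) 1) :
    ‖g 0 (x + k) - ∑ j ∈ Finset.range (r + 1), g j x * (k ^ j / j.factorial)‖ₑ ≤
      ENNReal.ofReal (|k| ^ (r + 1)) * ∫⁻ s in Set.Icc (0 : ℝ) 1, ‖g (r + 1) (x + s * k)‖ₑ := by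
  rw [chain_taylor r g h x (x + k) hx hk]
  simp only [add_sub_cancel_left]
  have := intervalIntegral.smul_integral_comp_add_mul (a := 0) (b := 1)
    (f := fun y => (x + k - y) ^ r / r.factorial * g (r + 1) y) k x
  simp only [mul_zero, add_zero, mul_one] at this
  rw [← this, enorm_smul, pow_succ', ENNReal.ofReal_mul (abs_nonneg k), ← Real.norm_eq_abs k,
    ofReal_norm, mul_assoc]
  gcongr
  refine (enorm_intervalIntegral_le _ zero_le_one).trans ?_
  rw [← lintegral_const_mul' _ _ ENNReal.ofReal_ne_top]
  refine setLIntegral_mono' measurableSet_Icc fun s hs => ?_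
  rw [enorm_mul, mul_comm k s]
  gcongr
  rw [← ofReal_norm]
  refine ENNReal.ofReal_le_ofReal ?_
  rw [norm_div, norm_pow, show x + k - (x + s * k) = (1 - s) * k by ring, norm_mul, mul_pow]
  have h1 : ‖(1 - s : ℝ)‖ ^ r ≤ 1 := by
    apply pow_le_one₀ (norm_nonneg _)
    rw [Real.norm_eq_abs, abs_le]; constructor <;> linarith [hs.1, hs.2]
  have h2 : (1 : ℝ) ≤ ‖(r.factorial : ℝ)‖ := by
    rw [Real.norm_natCast]; exact_mod_cast Nat.factorial_pos r
  rw [div_le_iff₀ (by linarith)]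
  have h3 : 0 ≤ ‖k‖ ^ r := by positivity
  nlinarith

noncomputable def Sop (w : ℝ → ℝ) (a : ℝ) (g : ℝ → ℝ) (x : ℝ) : ℝ :=
  ∫ y in (-1 : ℝ)..1, (1 / a) * w ((y - (1 - a) * x) / a) * g y

lemma Sop_cont (w : ℝ → ℝ) (hw : Continuous w) (a : ℝ) (g : ℝ → ℝ) (hg : Continuous g) :
    Continuous (Sop w a g) := by
  apply intervalIntegral.continuous_parametric_intervalIntegral_of_continuous'
  simp only [Function.uncurry_def]
  fun_prop

lemma lint_supp_le (k : ℝ → ℝ≥0∞) (M : ℝ≥0∞) (α β : ℝ) (h : ∀ x, k x ≤ M)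
    (h0 : ∀ x, x ∉ Set.Icc α β → k x = 0) : ∫⁻ x, k x ∂muI ≤ M * ENNReal.ofReal (β - α) := by
  calc _ ≤ ∫⁻ x, k x := lintegral_mono' Measure.restrict_le_self le_rfl
    _ ≤ ∫⁻ x, (Set.Icc α β).indicator (fun _ => M) x := by
        refine lintegral_mono fun x => ?_
        by_cases hx : x ∈ Set.Icc α β
        · rw [Set.indicator_of_mem hx]; exact h x
        · rw [h0 x hx]; exact zero_le
    _ = _ := by
        rw [lintegral_indicator measurableSet_Icc]; simp

lemma Sop_bound (w : ℝ → ℝ) (hw : Continuous w) (B : ℝ) (hB : 0 ≤ B) (hwB : ∀ x, |w x| ≤ B)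
    (hw0 : ∀ x, 1 ≤ |x| → w x = 0) (a : ℝ) (ha0 : 0 < a) (ha : a ≤ 1 / 2) (g : ℝ → ℝ)
    (hg : Continuous g) (p : ℝ≥0∞) (hp : 1 ≤ p) :
    eLpNorm (Sop w a g) p muI ≤ ENNReal.ofReal (4 * B) * eLpNorm g p muI := by
  have hM : ∀ x y : ℝ, ‖(1 / a) * w ((y - (1 - a) * x) / a)‖ₑ ≤ ENNReal.ofReal (B / a) := by
    intro x y
    rw [← ofReal_norm]
    refine ENNReal.ofReal_le_ofReal ?_
    rw [norm_mul, Real.norm_eq_abs, Real.norm_eq_abs, abs_of_pos (by positivity),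
      div_mul_eq_mul_div, one_mul]
    gcongr
    exact hwB _
  have hz : ∀ x y : ℝ, ¬ |y - (1 - a) * x| ≤ a → ‖(1 / a) * w ((y - (1 - a) * x) / a)‖ₑ = 0 := by
    intro x y h
    rw [hw0, mul_zero, enorm_zero]
    rw [abs_div, abs_of_pos ha0, le_div_iff₀ ha0]
    linarith
  refine schur_kernel (fun x y => ‖(1 / a) * w ((y - (1 - a) * x) / a)‖ₑ) g _ _
    ENNReal.ofReal_ne_top hg ?_ ?_ ?_ ?_ p hp
  · apply Measurable.enorm
    apply Continuous.measurable
    fun_prop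
  · intro x _
    refine (lint_supp_le _ _ ((1 - a) * x - a) ((1 - a) * x + a) (hM x) ?_).trans ?_
    · intro y hy
      refine hz x y fun h => hy ?_
      have := abs_le.1 h
      constructor <;> linarith
    · rw [← ENNReal.ofReal_mul (by positivity)]
      refine ENNReal.ofReal_le_ofReal ?_
      rw [show (1 - a) * x + a - ((1 - a) * x - a) = 2 * a by ring]
      rw [show B / a * (2 * a) = 2 * B by field_simp]
      linarith
  · intro y _
    have h1a : 0 < 1 - a := by linarith
    refine (lint_supp_le _ _ ((y - a) / (1 - a)) ((y + a) / (1 - a)) (fun x => hM x y) ?_).trans ?_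
    · intro x hx
      refine hz x y fun h => hx ?_
      have := abs_le.1 h
      constructor
      · rw [div_le_iff₀ h1a]; linarith
      · rw [le_div_iff₀ h1a]; linarith
    · rw [← ENNReal.ofReal_mul (by positivity)]
      refine ENNReal.ofReal_le_ofReal ?_
      rw [← sub_div, show y + a - (y - a) = 2 * a by ring,
        show B / a * (2 * a / (1 - a)) = 2 * B / (1 - a) by field_simp]
      rw [div_le_iff₀ h1a]
      nlinarith
  · intro x _
    refine (enorm_intervalIntegral_le _ (by norm_num)).trans ?_
    simp only [enorm_mul]
    rfl

lemma Sop_parts (w w' : ℝ → ℝ) (hw' : Continuous w') (hd : ∀ x, HasDerivAt w (w' x) x)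
    (hw0 : ∀ x, 1 ≤ |x| → w x = 0) (a : ℝ) (ha0 : 0 < a) (ha : a ≤ 1 / 2) (g g' : ℝ → ℝ)
    (hg : Continuous g) (hg' : Continuous g') (hgd : ∀ x ∈ Set.Ioo (-1 : ℝ) 1, HasDerivAt g (g' x) x)
    (x : ℝ) (hx : x ∈ Set.Icc (-1 : ℝ) 1) :
    Sop w' a g x = - a * Sop w a g' x := by
  have hw : Continuous w := continuous_iff_continuousAt.2 fun x => (hd x).continuousAt
  unfold Sop
  have hI : ∀ y ∈ Set.Ioo (min (-1 : ℝ) 1) (max (-1 : ℝ) 1), y ∈ Set.Ioo (-1 : ℝ) 1 := by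
    intro y hy; simpa using hy
  have := intervalIntegral.integral_mul_deriv_eq_deriv_mul_of_hasDeriv_right (a := -1) (b := 1)
    (u := fun y => w ((y - (1 - a) * x) / a)) (v := g)
    (u' := fun y => w' ((y - (1 - a) * x) / a) * (1 / a)) (v' := g')
    (by fun_prop) hg.continuousOn
    (fun y hy => by
      have h1 : HasDerivAt (fun y => (y - (1 - a) * x) / a) (1 / a) y :=
        ((hasDerivAt_id y).sub_const _).div_const a
      exact ((hd _).comp y h1).hasDerivWithinAt)
    (fun y hy => (hgd y (hI y hy)).hasDerivWithinAt)
    (Continuous.intervalIntegrable (by fun_prop) _ _) (hg'.intervalIntegrable _ _)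
  have b1 : w ((1 - (1 - a) * x) / a) = 0 := by
    apply hw0
    rw [abs_of_nonneg] <;> [rw [le_div_iff₀ ha0]; apply div_nonneg _ ha0.le] <;>
      nlinarith [hx.1, hx.2]
  have b2 : w ((-1 - (1 - a) * x) / a) = 0 := by
    apply hw0
    rw [abs_of_nonpos, ← neg_div] <;> [rw [le_div_iff₀ ha0]; apply div_nonpos_of_nonpos_of_nonneg _ ha0.le] <;>
      nlinarith [hx.1, hx.2]
  rw [b1, b2] at this
  simp only [zero_mul, sub_zero, zero_sub] at this
  have e1 : ∫ y in (-1 : ℝ)..1, 1 / a * w' ((y - (1 - a) * x) / a) * g y =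
      ∫ y in (-1 : ℝ)..1, w' ((y - (1 - a) * x) / a) * (1 / a) * g y := by
    congr 1; ext y; ring
  have e2 : ∫ y in (-1 : ℝ)..1, 1 / a * w ((y - (1 - a) * x) / a) * g' y =
      (1 / a) * ∫ y in (-1 : ℝ)..1, w ((y - (1 - a) * x) / a) * g' y := by
    rw [← intervalIntegral.integral_const_mul]
    congr 1; ext y; ring
  rw [e1, e2, this]
  field_simp

lemma Sop_iter (w : ℕ → ℝ → ℝ) (hw : ∀ j, Continuous (w j))
    (hd : ∀ j x, HasDerivAt (w j) (w (j + 1) x) x)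
    (hw0 : ∀ j x, 1 ≤ |x| → w j x = 0) (a : ℝ) (ha0 : 0 < a) (ha : a ≤ 1 / 2) (g : ℕ → ℝ → ℝ)
    (r : ℕ) (hg : IsCh r g) (x : ℝ) (hx : x ∈ Set.Icc (-1 : ℝ) 1) :
    ∀ i ≤ r, ∀ j, Sop (w (j + i)) a (g 0) x = (- a) ^ i * Sop (w j) a (g i) x := by
  intro i
  induction i with
  | zero => intro _ j; simp
  | succ i ih =>
    intro hi j
    rw [show j + (i + 1) = (j + 1) + i by ring, ih (by omega),
      Sop_parts (w j) (w (j + 1)) (hw _) (hd j) (hw0 j) a ha0 ha (g i) (g (i + 1))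
      (hg.1 i (by omega)) (hg.1 (i + 1) hi) (hg.2 i (by omega)) x hx]
    ring

lemma Sop_u (w : ℝ → ℝ) (hw0 : ∀ x, 1 ≤ |x| → w x = 0) (a : ℝ) (ha0 : 0 < a) (ha : a ≤ 1 / 2)
    (g : ℝ → ℝ) (x : ℝ) (hx : x ∈ Set.Icc (-1 : ℝ) 1) :
    Sop w a g x = ∫ u in (-1 : ℝ)..1, g (x + a * (u - x)) * w u := by
  have := intervalIntegral.smul_integral_comp_add_mul (a := -1) (b := 1)
    (f := fun y => (1 / a) * w ((y - (1 - a) * x) / a) * g y) a ((1 - a) * x)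
  have hsupp : ∀ α β : ℝ, α ≤ (1 - a) * x - a → (1 - a) * x + a ≤ β → Function.support
      (fun y => (1 / a) * w ((y - (1 - a) * x) / a) * g y) ⊆ Set.Ioc α β := by
    intro α β h1 h2 y hy
    by_contra h
    refine hy ?_
    simp only
    rw [hw0, mul_zero, zero_mul]
    rw [abs_div, abs_of_pos ha0, le_div_iff₀ ha0]
    by_contra h'
    have := abs_lt.1 (not_le.1 h')
    exact h ⟨by linarith, by linarith⟩
  unfold Sop
  rw [intervalIntegral.integral_eq_integral_of_support_subset (hsupp _ _ _ _),
    ← intervalIntegral.integral_eq_integral_of_support_subset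
      (hsupp ((1 - a) * x + a * (-1)) ((1 - a) * x + a * 1) (by linarith) (by linarith)), ← this,
    smul_eq_mul, ← intervalIntegral.integral_const_mul]
  · congr 1; ext u
    rw [show ((1 - a) * x + a * u - (1 - a) * x) / a = u by field_simp; ring]
    rw [show (1 - a) * x + a * u = x + a * (u - x) by ring]
    field_simp
  · nlinarith [hx.1, hx.2]
  · nlinarith [hx.1, hx.2]

lemma alt_sum (r : ℕ) (j : ℕ) (hj : j < r) :
    ∑ i ∈ Finset.range r, ((-1 : ℝ) ^ i * (r.choose (i + 1))) * ((i + 1 : ℕ) : ℝ) ^ j =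
      if j = 0 then 1 else 0 := by
  have h := congrFun (fwdDiff_iter_pow_eq_zero_of_lt (R := ℝ) hj) 0
  rw [fwdDiff_iter_eq_sum_shift, Finset.sum_range_succ'] at h
  simp only [Pi.zero_apply, zero_add] at h
  have e : ∀ i ∈ Finset.range r, ((-1 : ℝ) ^ i * (r.choose (i + 1))) * ((i + 1 : ℕ) : ℝ) ^ j =
     (-(-1) ^ r) * (((-1 : ℤ) ^ (r - (i + 1)) * (r.choose (i + 1))) • ((i + 1) • (1 : ℝ)) ^ j) := by
    intro i hi
    have hi := Finset.mem_range.1 hi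
    simp only [zsmul_eq_mul, nsmul_eq_mul, mul_one]
    push_cast
    have : (-1 : ℝ) ^ i = -(-1) ^ r * (-1) ^ (r - (i + 1)) := by
      obtain ⟨k, rfl⟩ : ∃ k, r = i + 1 + k := ⟨r - (i + 1), by omega⟩
      rw [Nat.add_sub_cancel_left, pow_add, pow_add, mul_comm (-((-1 : ℝ) ^ i * (-1) ^ 1 * _)), ← neg_mul]
      have : (-1 : ℝ) ^ k * (-1) ^ k = 1 := by rw [← mul_pow]; simp
      linear_combination (-(-1 : ℝ) ^ i) * this
    rw [this]; ring
  rw [Finset.sum_congr rfl e, ← Finset.mul_sum, eq_neg_of_add_eq_zero_left h]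
  have h1 : (-1 : ℝ) ^ r * (-1) ^ r = 1 := by rw [← mul_pow]; simp
  rcases Nat.eq_zero_or_pos j with rfl | hj0
  · simp
    exact h1
  · simp [hj0.ne']

noncomputable def cf (r i : ℕ) : ℝ := (-1 : ℝ) ^ i * (r.choose (i + 1))

noncomputable def SS (w : ℝ → ℝ) (r : ℕ) (δ : ℝ) (g : ℝ → ℝ) (x : ℝ) : ℝ :=
  ∑ i ∈ Finset.range r, cf r i * Sop w ((i + 1 : ℕ) * δ) g x

lemma enorm_const_mul_le (c : ℝ) (f : ℝ → ℝ) (p : ℝ≥0∞) (μ : Measure ℝ) :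
    eLpNorm (fun x => c * f x) p μ = ‖c‖ₑ * eLpNorm f p μ := by
  have := eLpNorm_const_smul (μ := μ) (p := p) c f
  exact this

lemma mem_conv_I (a x u : ℝ) (ha0 : 0 ≤ a) (ha : a ≤ 1 / 2) (hx : x ∈ Set.Icc (-1 : ℝ) 1)
    (hu : u ∈ Set.Icc (-1 : ℝ) 1) : x + a * (u - x) ∈ Set.Icc (-1 : ℝ) 1 := by
  constructor <;> nlinarith [hx.1, hx.2, hu.1, hu.2]

lemma SS_error (w : ℝ → ℝ) (hw : Continuous w) (B : ℝ) (hB : 0 ≤ B) (hwB : ∀ x, |w x| ≤ B)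
    (hw0 : ∀ x, 1 ≤ |x| → w x = 0) (hw1 : ∫ u in (-1 : ℝ)..1, w u = 1) (q : ℕ) :
    ∃ C : ℝ, 0 < C ∧ ∀ δ : ℝ, 0 < δ → ((q + 1 : ℕ) : ℝ) * δ ≤ 1 / 2 → ∀ g, IsCh (q + 1) g →
      ∀ p : ℝ≥0∞, 1 ≤ p → eLpNorm (fun x => g 0 x - SS w (q + 1) δ (g 0) x) p muI ≤
        ENNReal.ofReal (C * δ ^ (q + 1)) * eLpNorm (g (q + 1)) p muI := by
  refine ⟨∑ i ∈ Finset.range (q + 1), |cf (q + 1) i| * (4 * (B * (2 * (q + 1 : ℕ)) ^ (q + 1))) + 1,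
    by positivity, ?_⟩
  intro δ hδ hδ2 g hg p hp
  set T : ℝ → ℝ → ℝ := fun x k => ∑ j ∈ Finset.range (q + 1), g j x * (k ^ j / j.factorial) with hT
  set D : ℕ → ℝ → ℝ := fun i x => ∫ u in (-1 : ℝ)..1,
    (T x (((i + 1 : ℕ) * δ) * (u - x)) - g 0 (x + ((i + 1 : ℕ) * δ) * (u - x))) * w u with hD
  have hTc : Continuous (Function.uncurry T) := by
    simp only [hT, Function.uncurry_def]
    refine continuous_finsetSum _ fun j hj => ?_
    have := hg.1 j (by have := Finset.mem_range.1 hj; omega)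
    fun_prop
  have hg0 : Continuous (g 0) := hg.1 0 (by omega)
  have hTc2 : ∀ c : ℝ, Continuous (fun z : ℝ × ℝ => T z.1 (c * (z.2 - z.1))) := fun c =>
    hTc.comp (by fun_prop : Continuous fun z : ℝ × ℝ => (z.1, c * (z.2 - z.1)))
  have hDc : ∀ i, Continuous (D i) := by
    intro i
    apply intervalIntegral.continuous_parametric_intervalIntegral_of_continuous'
    simp only [Function.uncurry_def]
    have := hTc2 ((i + 1 : ℕ) * δ)
    fun_prop
  have hai : ∀ i ∈ Finset.range (q + 1), ((i + 1 : ℕ) : ℝ) * δ ≤ (q + 1 : ℕ) * δ := by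
    intro i hi
    have := Finset.mem_range.1 hi
    gcongr
    omega
  have hDb : ∀ i ∈ Finset.range (q + 1), eLpNorm (D i) p muI ≤
      ENNReal.ofReal (4 * (B * (2 * ((q + 1 : ℕ) * δ)) ^ (q + 1))) * eLpNorm (g (q + 1)) p muI := by
    intro i hi
    set a : ℝ := (i + 1 : ℕ) * δ with ha
    have ha0 : 0 < a := by positivity
    have ha2 : a ≤ 1 / 2 := (hai i hi).trans hδ2
    refine avg_bound (g (q + 1)) (D i) (hg.1 _ le_rfl) _ (by positivity) a ha0.le ha2 ?_ p hp
    intro x hx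
    refine (enorm_intervalIntegral_le _ (by norm_num)).trans ?_
    rw [← lintegral_const_mul' _ _ ENNReal.ofReal_ne_top]
    refine setLIntegral_mono' measurableSet_Icc fun u hu => ?_
    rw [enorm_mul, ← neg_sub, enorm_neg]
    have h1 := chain_taylor_bd q g hg x (a * (u - x)) hx (mem_conv_I a x u ha0.le ha2 hx hu)
    have h2 : ∀ s : ℝ, x + s * (a * (u - x)) = (1 - s * a) * x + s * a * u := fun s => by ring
    simp only [h2] at h1
    have h3 : |a * (u - x)| ≤ 2 * ((q + 1 : ℕ) * δ) := by
      rw [abs_mul, abs_of_pos ha0]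
      have : |u - x| ≤ 2 := by rw [abs_le]; constructor <;> linarith [hx.1, hx.2, hu.1, hu.2]
      nlinarith [hai i hi]
    calc _ ≤ (ENNReal.ofReal (|a * (u - x)| ^ (q + 1)) *
          ∫⁻ s in Set.Icc (0 : ℝ) 1, ‖g (q + 1) ((1 - s * a) * x + s * a * u)‖ₑ) * ENNReal.ofReal B := by
          gcongr
          rw [← ofReal_norm]
          exact ENNReal.ofReal_le_ofReal (hwB u)
      _ ≤ (ENNReal.ofReal ((2 * ((q + 1 : ℕ) * δ)) ^ (q + 1)) *
          ∫⁻ s in Set.Icc (0 : ℝ) 1, ‖g (q + 1) ((1 - s * a) * x + s * a * u)‖ₑ) * ENNReal.ofReal B := by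
          gcongr
      _ = _ := by
          rw [ENNReal.ofReal_mul hB]; ring
  have hrep : ∀ x ∈ Set.Icc (-1 : ℝ) 1, g 0 x - SS w (q + 1) δ (g 0) x =
      ∑ i ∈ Finset.range (q + 1), cf (q + 1) i * D i x := by
    intro x hx
    have hsplit : ∀ i ∈ Finset.range (q + 1), D i x =
        (∫ u in (-1 : ℝ)..1, T x (((i + 1 : ℕ) * δ) * (u - x)) * w u) - Sop w ((i + 1 : ℕ) * δ) (g 0) x := by
      intro i hi
      rw [Sop_u w hw0 _ (by positivity) ((hai i hi).trans hδ2) (g 0) x hx, ← intervalIntegral.integral_sub]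
      · simp only [hD, sub_mul]
      · have : Continuous fun u => T x (((i + 1 : ℕ) * δ) * (u - x)) :=
          (hTc2 _).comp (by fun_prop : Continuous fun u : ℝ => (x, u))
        exact (this.mul hw).intervalIntegrable _ _
      · exact Continuous.intervalIntegrable (by fun_prop) _ _
    have hmain : ∑ i ∈ Finset.range (q + 1), cf (q + 1) i *
        (∫ u in (-1 : ℝ)..1, T x (((i + 1 : ℕ) * δ) * (u - x)) * w u) = g 0 x := by
      simp only [← intervalIntegral.integral_const_mul]
      rw [← intervalIntegral.integral_finsetSum]
      · have : ∀ u : ℝ, ∑ i ∈ Finset.range (q + 1), cf (q + 1) i *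
            (T x (((i + 1 : ℕ) * δ) * (u - x)) * w u) = g 0 x * w u := by
          intro u
          simp only [← mul_assoc, ← Finset.sum_mul]
          congr 1
          simp only [hT, Finset.mul_sum]
          rw [Finset.sum_comm]
          have : ∀ j ∈ Finset.range (q + 1), ∑ i ∈ Finset.range (q + 1),
              cf (q + 1) i * (g j x * (((i + 1 : ℕ) * δ * (u - x)) ^ j / j.factorial)) =
              g j x * ((δ * (u - x)) ^ j / j.factorial) * if j = 0 then 1 else 0 := by
            intro j hj
            rw [← alt_sum (q + 1) j (Finset.mem_range.1 hj), Finset.mul_sum]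
            refine Finset.sum_congr rfl fun i _ => ?_
            rw [cf, mul_assoc ((i + 1 : ℕ) : ℝ), mul_pow ((i + 1 : ℕ) : ℝ)]
            ring
          rw [Finset.sum_congr rfl this, Finset.sum_eq_single 0]
          · simp
          · intro j _ hj; simp [hj]
          · simp
        simp only [this]
        rw [intervalIntegral.integral_const_mul, hw1, mul_one]
      · intro i _
        have : Continuous fun u => T x (((i + 1 : ℕ) * δ) * (u - x)) :=
          (hTc2 _).comp (by fun_prop : Continuous fun u : ℝ => (x, u))
        exact Continuous.intervalIntegrable (by fun_prop) _ _
    rw [SS, ← hmain, ← Finset.sum_sub_distrib]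
    refine Finset.sum_congr rfl fun i hi => ?_
    rw [hsplit i hi, mul_sub]
  calc _ = eLpNorm (∑ i ∈ Finset.range (q + 1), fun x => cf (q + 1) i * D i x) p muI := by
        refine eLpNorm_congr_ae ?_
        refine (ae_restrict_iff' measurableSet_Icc).2 (Filter.Eventually.of_forall fun x hx => ?_)
        simp only [hrep x hx, Finset.sum_apply]
    _ ≤ ∑ i ∈ Finset.range (q + 1), eLpNorm (fun x => cf (q + 1) i * D i x) p muI :=
        eLpNorm_sum_le (fun i _ => ((hDc i).const_mul _).aestronglyMeasurable) hp
    _ ≤ ∑ i ∈ Finset.range (q + 1), ENNReal.ofReal (|cf (q + 1) i| *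
          (4 * (B * (2 * (q + 1 : ℕ)) ^ (q + 1))) * δ ^ (q + 1)) * eLpNorm (g (q + 1)) p muI := by
        refine Finset.sum_le_sum fun i hi => ?_
        rw [enorm_const_mul_le, mul_assoc |cf (q + 1) i|, ENNReal.ofReal_mul (abs_nonneg _), mul_assoc,
          ← Real.norm_eq_abs, ofReal_norm]
        gcongr
        refine (hDb i hi).trans_eq ?_
        congr 2
        rw [← mul_assoc, mul_pow]
        ring
    _ ≤ _ := by
        rw [← Finset.sum_mul, ← ENNReal.ofReal_sum_of_nonneg (fun i _ => by positivity), ← Finset.sum_mul]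
        gcongr
        linarith

noncomputable def aof (δ : ℝ) (i : ℕ) : ℝ := ((i + 1 : ℕ) : ℝ) * δ

noncomputable def kap (w : ℕ → ℝ → ℝ) (r : ℕ) (δ : ℝ) (j : ℕ) (x z : ℝ) : ℝ :=
  ∑ i ∈ Finset.range r, cf r i * (-((1 - aof δ i) / aof δ i)) ^ j *
    ((1 / aof δ i) * w j ((z - (1 - aof δ i) * x) / aof δ i))

noncomputable def Vop (w : ℕ → ℝ → ℝ) (r : ℕ) (δ : ℝ) (j : ℕ) (g : ℝ → ℝ) (x : ℝ) : ℝ :=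
  ∑ i ∈ Finset.range r, cf r i * (-((1 - aof δ i) / aof δ i)) ^ j * Sop (w j) (aof δ i) g x

lemma kap_cont (w : ℕ → ℝ → ℝ) (hw : ∀ j, Continuous (w j)) (r : ℕ) (δ : ℝ) (j : ℕ) :
    Continuous (fun z : ℝ × ℝ => kap w r δ j z.1 z.2) := by
  unfold kap
  have := hw j
  refine continuous_finsetSum _ fun i _ => ?_
  fun_prop

lemma Vop_cont (w : ℕ → ℝ → ℝ) (hw : ∀ j, Continuous (w j)) (r : ℕ) (δ : ℝ) (j : ℕ) (g : ℝ → ℝ)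
    (hg : Continuous g) : Continuous (Vop w r δ j g) := by
  unfold Vop
  refine continuous_finsetSum _ fun i _ => ?_
  exact (Sop_cont _ (hw j) _ g hg).const_mul _

lemma Vop_eq (w : ℕ → ℝ → ℝ) (hw : ∀ j, Continuous (w j)) (r : ℕ) (δ : ℝ) (j : ℕ) (g : ℝ → ℝ)
    (hg : Continuous g) (x : ℝ) :
    Vop w r δ j g x = ∫ z in (-1 : ℝ)..1, kap w r δ j x z * g z := by
  unfold Vop kap Sop
  simp only [Finset.sum_mul]
  have := hw j
  rw [intervalIntegral.integral_finsetSum]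
  · refine Finset.sum_congr rfl fun i _ => ?_
    rw [← intervalIntegral.integral_const_mul]
    congr 1; ext z; ring
  · intro i _
    exact Continuous.intervalIntegrable (by fun_prop) _ _

lemma kap_ch (w : ℕ → ℝ → ℝ) (hw : ∀ j, Continuous (w j))
    (hd : ∀ j x, HasDerivAt (w j) (w (j + 1) x) x) (r : ℕ) (δ : ℝ) (z : ℝ) (n : ℕ) :
    IsCh n (fun j x => kap w r δ j x z) := by
  refine ⟨fun j _ => (kap_cont w hw r δ j).comp (by fun_prop : Continuous fun x : ℝ => (x, z)), ?_⟩
  intro j _ x _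
  unfold kap
  refine HasDerivAt.fun_sum fun i _ => ?_
  set a := aof δ i
  have h1 : HasDerivAt (fun x => (z - (1 - a) * x) / a) (-((1 - a) / a)) x := by
    have := (((hasDerivAt_id x).const_mul (1 - a)).const_sub z).div_const a
    refine this.congr_deriv ?_
    ring
  have h2 := (((hd j _).comp x h1).const_mul (1 / a)).const_mul (cf r i * (-((1 - a) / a)) ^ j)
  refine h2.congr_deriv ?_
  ring

lemma Vop_zero (w : ℕ → ℝ → ℝ) (r : ℕ) (δ : ℝ) (g : ℝ → ℝ) : Vop w r δ 0 g = SS (w 0) r δ g := by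
  ext x
  simp [Vop, SS, aof]

lemma aof_bd (δ : ℝ) (hδ : 0 < δ) (r : ℕ) (h : (r : ℝ) * δ ≤ 1 / 2) (i : ℕ) (hi : i ∈ Finset.range r) :
    0 < aof δ i ∧ aof δ i ≤ 1 / 2 ∧ δ ≤ aof δ i := by
  have hi := Finset.mem_range.1 hi
  refine ⟨by unfold aof; positivity, le_trans ?_ h, ?_⟩
  · unfold aof; gcongr; omega
  · unfold aof
    have : (1 : ℝ) ≤ (i + 1 : ℕ) := by exact_mod_cast Nat.le_add_left 1 i
    nlinarith

lemma sum_bound (r : ℕ) (f : ℕ → ℝ → ℝ) (hf : ∀ i, Continuous (f i)) (c : ℕ → ℝ) (D : ℝ) (M : ℝ≥0∞)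
    (p : ℝ≥0∞) (hp : 1 ≤ p) (h : ∀ i ∈ Finset.range r, eLpNorm (f i) p muI ≤ ENNReal.ofReal D * M) :
    eLpNorm (fun x => ∑ i ∈ Finset.range r, c i * f i x) p muI ≤
      ENNReal.ofReal ((∑ i ∈ Finset.range r, |c i|) * D) * M := by
  have : (fun x => ∑ i ∈ Finset.range r, c i * f i x) = ∑ i ∈ Finset.range r, fun x => c i * f i x := by
    ext x; simp
  rw [this]
  calc _ ≤ ∑ i ∈ Finset.range r, eLpNorm (fun x => c i * f i x) p muI :=
        eLpNorm_sum_le (fun i _ => ((hf i).const_mul _).aestronglyMeasurable) hp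
    _ ≤ ∑ i ∈ Finset.range r, ENNReal.ofReal |c i| * (ENNReal.ofReal D * M) := by
        refine Finset.sum_le_sum fun i hi => ?_
        rw [enorm_const_mul_le, ← Real.norm_eq_abs, ofReal_norm]
        gcongr
        exact h i hi
    _ = _ := by
        rw [← Finset.sum_mul, ← ENNReal.ofReal_sum_of_nonneg (fun i _ => abs_nonneg _), ← mul_assoc,
          ← ENNReal.ofReal_mul (Finset.sum_nonneg fun i _ => abs_nonneg _)]

noncomputable def cS (r : ℕ) : ℝ := ∑ i ∈ Finset.range r, |cf r i|

lemma cS_nonneg (r : ℕ) : 0 ≤ cS r := Finset.sum_nonneg fun i _ => abs_nonneg _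

lemma Vop_bound (w : ℕ → ℝ → ℝ) (B : ℕ → ℝ) (hw : ∀ j, Continuous (w j))
    (hw0 : ∀ j x, 1 ≤ |x| → w j x = 0) (hwB : ∀ j x, |w j x| ≤ B j) (hB : ∀ j, 0 < B j)
    (r : ℕ) (δ : ℝ) (hδ : 0 < δ) (h : (r : ℝ) * δ ≤ 1 / 2) (j : ℕ) (g : ℝ → ℝ) (hg : Continuous g)
    (p : ℝ≥0∞) (hp : 1 ≤ p) :
    eLpNorm (Vop w r δ j g) p muI ≤
      ENNReal.ofReal (cS r * (4 * B j / δ ^ j)) * eLpNorm g p muI := by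
  have e : Vop w r δ j g = fun x => ∑ i ∈ Finset.range r, cf r i *
      ((-((1 - aof δ i) / aof δ i)) ^ j * Sop (w j) (aof δ i) g x) := by
    ext x; unfold Vop; refine Finset.sum_congr rfl fun i _ => by ring
  rw [e]
  refine sum_bound r _ (fun i => (Sop_cont _ (hw j) _ g hg).const_mul _) (cf r) _ _ p hp fun i hi => ?_
  obtain ⟨h1, h2, h3⟩ := aof_bd δ hδ r h i hi
  rw [enorm_const_mul_le]
  calc _ ≤ ENNReal.ofReal (1 / δ ^ j) * (ENNReal.ofReal (4 * B j) * eLpNorm g p muI) := by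
        gcongr
        · rw [← ofReal_norm]
          refine ENNReal.ofReal_le_ofReal ?_
          rw [norm_pow, norm_neg, Real.norm_eq_abs, abs_of_nonneg (div_nonneg (by linarith) h1.le),
            ← one_div_pow]
          refine pow_le_pow_left₀ (div_nonneg (by linarith) h1.le) ?_ j
          gcongr
          linarith
        · exact Sop_bound (w j) (hw j) (B j) (hB j).le (hwB j) (hw0 j) _ h1 h2 g hg p hp
    _ = _ := by
        rw [← mul_assoc, ← ENNReal.ofReal_mul (by positivity)]
        congr 2; ring

lemma Vop_chain_bound (w : ℕ → ℝ → ℝ) (B : ℕ → ℝ) (hw : ∀ j, Continuous (w j))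
    (hd : ∀ j x, HasDerivAt (w j) (w (j + 1) x) x)
    (hw0 : ∀ j x, 1 ≤ |x| → w j x = 0) (hwB : ∀ j x, |w j x| ≤ B j) (hB : ∀ j, 0 < B j)
    (r : ℕ) (δ : ℝ) (hδ : 0 < δ) (h : (r : ℝ) * δ ≤ 1 / 2) (n : ℕ) (g : ℕ → ℝ → ℝ) (hg : IsCh n g)
    (p : ℝ≥0∞) (hp : 1 ≤ p) :
    eLpNorm (Vop w r δ n (g 0)) p muI ≤
      ENNReal.ofReal (cS r * (4 * B 0)) * eLpNorm (g n) p muI := by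
  have e : eLpNorm (Vop w r δ n (g 0)) p muI = eLpNorm (fun x => ∑ i ∈ Finset.range r, cf r i *
      ((1 - aof δ i) ^ n * Sop (w 0) (aof δ i) (g n) x)) p muI := by
    refine eLpNorm_congr_ae ?_
    refine (ae_restrict_iff' measurableSet_Icc).2 (Filter.Eventually.of_forall fun x hx => ?_)
    unfold Vop
    refine Finset.sum_congr rfl fun i hi => ?_
    obtain ⟨h1, h2, h3⟩ := aof_bd δ hδ r h i hi
    have := Sop_iter w hw hd hw0 (aof δ i) h1 h2 g n hg x hx n le_rfl 0
    rw [zero_add] at this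
    rw [this, ← mul_assoc, mul_assoc (cf r i), ← mul_pow]
    have : -((1 - aof δ i) / aof δ i) * -aof δ i = 1 - aof δ i := by field_simp
    rw [this]; ring
  rw [e]
  refine sum_bound r _ (fun i => (Sop_cont _ (hw 0) _ _ (hg.1 n le_rfl)).const_mul _) (cf r) _ _ p hp
    fun i hi => ?_
  obtain ⟨h1, h2, h3⟩ := aof_bd δ hδ r h i hi
  rw [enorm_const_mul_le]
  calc _ ≤ 1 * (ENNReal.ofReal (4 * B 0) * eLpNorm (g n) p muI) := by
        gcongr
        · rw [← ofReal_norm, ← ENNReal.ofReal_one]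
          refine ENNReal.ofReal_le_ofReal ?_
          rw [norm_pow, Real.norm_eq_abs, abs_of_nonneg (by linarith)]
          exact pow_le_one₀ (by linarith) (by linarith)
        · exact Sop_bound (w 0) (hw 0) (B 0) (hB 0).le (hwB 0) (hw0 0) _ h1 h2 _ (hg.1 n le_rfl) p hp
    _ = _ := by rw [one_mul]

noncomputable def Qop (k : ℕ → ℝ → ℝ) (N : ℕ) (g : ℝ → ℝ) (x : ℝ) : ℝ :=
  ∑ l ∈ Finset.range N, x ^ l * ∫ z in (-1 : ℝ)..1, k l z * g z

lemma tpow_conv' (s : ℕ) (e : ℝ → ℝ) (a b t : ℝ) (ht : t ∈ Set.Icc a b) :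
    ∫ y in a..b, tpow s (t - y) * e y = ∫ y in a..t, (t - y) ^ s * e y := by
  rw [← tpow_conv _ a b t ht]
  congr 1; ext y
  unfold tpow
  split_ifs <;> simp

/-- coefficient functions of the polynomial kernel -/
noncomputable def kco (w : ℕ → ℝ → ℝ) (q : ℕ) (δ : ℝ) (P : Polynomial ℝ) (l : ℕ) (z : ℝ) : ℝ :=
  ∑ j ∈ Finset.range (q + 1), kap w (q + 1) δ j (-1) z *
      ((Polynomial.hasseDeriv l (Polynomial.X ^ j : Polynomial ℝ)).eval (-(-1)) / j.factorial) +
    (1 / q.factorial) * ∫ y in (-1 : ℝ)..1, (Polynomial.hasseDeriv l P).eval (-y) *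
      kap w (q + 1) δ (q + 1) y z

lemma kco_cont (w : ℕ → ℝ → ℝ) (hw : ∀ j, Continuous (w j)) (q : ℕ) (δ : ℝ) (P : Polynomial ℝ) (l : ℕ) :
    Continuous (kco w q δ P l) := by
  unfold kco
  refine Continuous.add ?_ (Continuous.const_mul ?_ _)
  · refine continuous_finsetSum _ fun j _ => Continuous.mul_const ?_ _
    exact (kap_cont w hw (q + 1) δ j).comp (by fun_prop : Continuous fun z : ℝ => ((-1 : ℝ), z))
  · apply intervalIntegral.continuous_parametric_intervalIntegral_of_continuous'
    simp only [Function.uncurry_def]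
    refine Continuous.mul ?_ ?_
    · exact (Polynomial.continuous _).comp (by fun_prop)
    · exact (kap_cont w hw (q + 1) δ (q + 1)).comp (by fun_prop : Continuous fun z : ℝ × ℝ => (z.2, z.1))

lemma kco_sum (w : ℕ → ℝ → ℝ) (hw : ∀ j, Continuous (w j)) (q : ℕ) (δ : ℝ) (P : Polynomial ℝ) (n : ℕ)
    (hP : P.natDegree ≤ n) (hq : q ≤ n) (x z : ℝ) :
    ∑ l ∈ Finset.range (n + 1), x ^ l * kco w q δ P l z =
      ∑ j ∈ Finset.range (q + 1), kap w (q + 1) δ j (-1) z * ((x + 1) ^ j / j.factorial) +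
      (1 / q.factorial) * ∫ y in (-1 : ℝ)..1, P.eval (x - y) * kap w (q + 1) δ (q + 1) y z := by
  unfold kco
  simp only [mul_add, Finset.sum_add_distrib]
  congr 1
  · simp only [Finset.mul_sum]
    rw [Finset.sum_comm]
    refine Finset.sum_congr rfl fun j hj => ?_
    have hj := Finset.mem_range.1 hj
    have := poly_eval_sub (Polynomial.X ^ j : Polynomial ℝ) n (by simp; omega) x (-1)
    rw [Polynomial.eval_pow, Polynomial.eval_X, sub_neg_eq_add] at this
    rw [this, Finset.sum_div, Finset.mul_sum]
    refine Finset.sum_congr rfl fun l _ => ?_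
    ring
  · have : ∀ y, P.eval (x - y) = ∑ l ∈ Finset.range (n + 1), x ^ l * (Polynomial.hasseDeriv l P).eval (-y) :=
      fun y => poly_eval_sub P n hP x y
    simp only [this, Finset.sum_mul]
    rw [intervalIntegral.integral_finsetSum, Finset.mul_sum]
    · refine Finset.sum_congr rfl fun l _ => ?_
      rw [← mul_assoc, mul_comm (x ^ l), mul_assoc, ← intervalIntegral.integral_const_mul]
      congr 2; ext y; ring
    · intro l _
      have h1 := (kap_cont w hw (q + 1) δ (q + 1)).comp (by fun_prop : Continuous fun y : ℝ => (y, z))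
      have h2 : Continuous fun y : ℝ => (Polynomial.hasseDeriv l P).eval (-y) :=
        (Polynomial.continuous _).comp (by fun_prop)
      exact ((h2.const_mul _).mul h1).intervalIntegrable _ _

lemma Qop_eq (k : ℕ → ℝ → ℝ) (hk : ∀ l, Continuous (k l)) (N : ℕ) (g : ℝ → ℝ) (hg : Continuous g) (x : ℝ) :
    Qop k N g x = ∫ z in (-1 : ℝ)..1, (∑ l ∈ Finset.range N, x ^ l * k l z) * g z := by
  unfold Qop
  simp only [Finset.sum_mul]
  rw [intervalIntegral.integral_finsetSum]
  · refine Finset.sum_congr rfl fun l _ => ?_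
    rw [← intervalIntegral.integral_const_mul]
    congr 1; ext z; ring
  · intro l _
    have := hk l
    exact Continuous.intervalIntegrable (by fun_prop) _ _

lemma Qop_cont (k : ℕ → ℝ → ℝ) (N : ℕ) (g : ℝ → ℝ) : Continuous (Qop k N g) := by
  unfold Qop
  refine continuous_finsetSum _ fun l _ => ?_
  fun_prop

lemma Qdiff (w : ℕ → ℝ → ℝ) (hw : ∀ j, Continuous (w j))
    (hd : ∀ j x, HasDerivAt (w j) (w (j + 1) x) x) (q : ℕ) (δ : ℝ) (P : Polynomial ℝ) (n : ℕ)
    (hP : P.natDegree ≤ n) (hq : q ≤ n) (g : ℝ → ℝ) (hg : Continuous g) (x : ℝ)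
    (hx : x ∈ Set.Icc (-1 : ℝ) 1) :
    SS (w 0) (q + 1) δ g x - Qop (kco w q δ P) (n + 1) g x =
      (1 / q.factorial) * ∫ y in (-1 : ℝ)..1, (tpow q (x - y) - P.eval (x - y)) *
        Vop w (q + 1) δ (q + 1) g y := by
  have hkc : ∀ z, Continuous fun y => kap w (q + 1) δ (q + 1) y z := fun z =>
    (kap_cont w hw (q + 1) δ (q + 1)).comp (by fun_prop : Continuous fun y : ℝ => (y, z))
  have hPc : Continuous fun y => P.eval (x - y) := (Polynomial.continuous _).comp (by fun_prop)
  have htm : Measurable fun y => tpow q (x - y) := (tpow_meas q).comp (by fun_prop)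
  have htb : ∀ y ∈ Set.Icc (-1 : ℝ) 1, |tpow q (x - y)| ≤ 2 ^ q := by
    intro y hy
    unfold tpow
    split_ifs with h
    · rw [abs_of_pos (by positivity)]
      gcongr
      linarith [hx.2, hy.1]
    · simp
  have hti : IntervalIntegrable (fun y => tpow q (x - y)) volume (-1) 1 := by
    rw [intervalIntegrable_iff_integrableOn_Icc_of_le (by norm_num)]
    refine Measure.integrableOn_of_bounded (M := 2 ^ q) (by simp) htm.aestronglyMeasurable ?_
    refine (ae_restrict_iff' measurableSet_Icc).2 (Filter.Eventually.of_forall fun y hy => ?_)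
    exact htb y hy
  have hker : ∀ z, kap w (q + 1) δ 0 x z - ∑ l ∈ Finset.range (n + 1), x ^ l * kco w q δ P l z =
      (1 / q.factorial) * ∫ y in (-1 : ℝ)..1, (tpow q (x - y) - P.eval (x - y)) *
        kap w (q + 1) δ (q + 1) y z := by
    intro z
    rw [kco_sum w hw q δ P n hP hq]
    have h1 := chain_taylor q _ (kap_ch w hw hd (q + 1) δ z (q + 1)) (-1) x (by simp) hx
    rw [h1]
    have h2 : ∫ y in (-1 : ℝ)..x, (x - y) ^ q / q.factorial * kap w (q + 1) δ (q + 1) y z =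
        (1 / q.factorial) * ∫ y in (-1 : ℝ)..1, tpow q (x - y) * kap w (q + 1) δ (q + 1) y z := by
      rw [tpow_conv' q _ (-1) 1 x hx, ← intervalIntegral.integral_const_mul]
      congr 1; ext y; ring
    rw [h2]
    simp only [sub_neg_eq_add, sub_mul]
    rw [intervalIntegral.integral_sub]
    · ring
    · exact hti.mul_continuousOn (hkc z).continuousOn
    · exact (hPc.mul (hkc z)).intervalIntegrable _ _
  have hkz : ∀ j, Continuous fun z => kap w (q + 1) δ j x z := fun j =>
    (kap_cont w hw (q + 1) δ j).comp (by fun_prop : Continuous fun y : ℝ => (x, y))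
  have hks : Continuous fun z => ∑ l ∈ Finset.range (n + 1), x ^ l * kco w q δ P l z :=
    continuous_finsetSum _ fun l _ => (kco_cont w hw q δ P l).const_mul _
  have hkg : Continuous fun z => kap w (q + 1) δ 0 x z * g z := (hkz 0).mul hg
  have hksg : Continuous fun z => (∑ l ∈ Finset.range (n + 1), x ^ l * kco w q δ P l z) * g z := hks.mul hg
  rw [← Vop_zero, Vop_eq w hw _ _ _ g hg, Qop_eq _ (kco_cont w hw q δ P) _ g hg,
    ← intervalIntegral.integral_sub (hkg.intervalIntegrable _ _)
      (hksg.intervalIntegrable _ _)]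
  simp only [← sub_mul, hker]
  simp only [Vop_eq w hw _ _ _ g hg, mul_assoc]
  rw [intervalIntegral.integral_const_mul]
  congr 1
  simp only [← intervalIntegral.integral_mul_const, ← intervalIntegral.integral_const_mul]
  rw [intervalIntegral_intervalIntegral_swap]
  · congr 1; ext y; congr 1; ext z; ring
  · rw [Set.uIoc_of_le (by norm_num)]
    have hc : Continuous fun z : ℝ × ℝ => kap w (q + 1) δ (q + 1) z.2 z.1 * g z.1 := by
      have := (kap_cont w hw (q + 1) δ (q + 1)).comp (by fun_prop : Continuous fun z : ℝ × ℝ => (z.2, z.1))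
      exact this.mul (hg.comp continuous_fst)
    have hK : IsCompact (Set.Icc (-1 : ℝ) 1 ×ˢ Set.Icc (-1 : ℝ) 1) := isCompact_Icc.prod isCompact_Icc
    obtain ⟨M, hM⟩ := hK.exists_bound_of_continuousOn hc.continuousOn
    obtain ⟨M2, hM2⟩ := (isCompact_Icc (a := (-1 : ℝ)) (b := 1)).exists_bound_of_continuousOn hPc.continuousOn
    have hsub : Set.Ioc (-1 : ℝ) 1 ×ˢ Set.Ioc (-1 : ℝ) 1 ⊆ Set.Icc (-1 : ℝ) 1 ×ˢ Set.Icc (-1 : ℝ) 1 :=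
      Set.prod_mono Set.Ioc_subset_Icc_self Set.Ioc_subset_Icc_self
    refine IntegrableOn.mono_set ?_ hsub
    refine Measure.integrableOn_of_bounded (M := (2 ^ q + M2) * M) hK.measure_lt_top.ne ?_ ?_
    · apply Measurable.aestronglyMeasurable
      have hm : Measurable fun z : ℝ × ℝ => (tpow q (x - z.2) - P.eval (x - z.2)) *
          (kap w (q + 1) δ (q + 1) z.2 z.1 * g z.1) :=
        ((htm.comp measurable_snd).sub (hPc.measurable.comp measurable_snd)).mul hc.measurable
      simpa only [Function.uncurry_def, mul_assoc] using hm
    · refine (ae_restrict_iff' hK.measurableSet).2 (Filter.Eventually.of_forall fun z hz => ?_)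
      simp only [Function.uncurry_def]
      rw [mul_assoc, norm_mul]
      refine mul_le_mul ((norm_sub_le _ _).trans (add_le_add (htb _ hz.2) (hM2 _ hz.2))) (hM z hz)
        (norm_nonneg _) ?_
      exact add_nonneg (by positivity) ((norm_nonneg _).trans (hM2 _ hz.2))

lemma Qdiff_bound (w : ℕ → ℝ → ℝ) (hw : ∀ j, Continuous (w j))
    (hd : ∀ j x, HasDerivAt (w j) (w (j + 1) x) x) (q : ℕ) (δ : ℝ) (P : Polynomial ℝ) (n : ℕ)
    (hP : P.natDegree ≤ n) (hq : q ≤ n) (ε : ℝ)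
    (hE : ∫⁻ t in Set.Icc (-2 : ℝ) 2, ‖tpow q t - P.eval t‖ₑ ≤ ENNReal.ofReal ε)
    (g : ℝ → ℝ) (hg : Continuous g) (p : ℝ≥0∞) (hp : 1 ≤ p) :
    eLpNorm (fun x => SS (w 0) (q + 1) δ g x - Qop (kco w q δ P) (n + 1) g x) p muI ≤
      ENNReal.ofReal ε * eLpNorm (Vop w (q + 1) δ (q + 1) g) p muI := by
  have hm : Measurable fun t => ‖tpow q t - P.eval t‖ₑ :=
    ((tpow_meas q).sub P.continuous.measurable).enorm
  refine schur_kernel (fun x y => ‖tpow q (x - y) - P.eval (x - y)‖ₑ) _ _ _ ENNReal.ofReal_ne_top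
    (Vop_cont w hw _ _ _ g hg) (hm.comp (measurable_fst.sub measurable_snd)) ?_ ?_ ?_ p hp
  · intro x hx
    refine le_trans ?_ hE
    refine lint_transl_le' (fun t => ‖tpow q t - P.eval t‖ₑ) _ _ measurableSet_Icc measurableSet_Icc x ?_
    intro t ht
    constructor <;> linarith [ht.1, ht.2, hx.1, hx.2]
  · intro y hy
    refine le_trans ?_ hE
    refine lint_transl_le (fun t => ‖tpow q t - P.eval t‖ₑ) _ _ measurableSet_Icc measurableSet_Icc y ?_
    intro t ht
    constructor <;> linarith [ht.1, ht.2, hy.1, hy.2]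
  · intro x hx
    rw [Qdiff w hw hd q δ P n hP hq g hg x hx, enorm_mul]
    have h1 : ‖(1 / q.factorial : ℝ)‖ₑ ≤ 1 := by
      rw [← ofReal_norm, ← ENNReal.ofReal_one]
      refine ENNReal.ofReal_le_ofReal ?_
      rw [norm_div, norm_one, Real.norm_natCast, div_le_one (by positivity)]
      exact_mod_cast Nat.factorial_pos q
    refine (mul_le_mul' h1 (enorm_intervalIntegral_le _ (by norm_num))).trans_eq ?_
    rw [one_mul]
    simp only [enorm_mul]
    rfl

theorem oneD (q : ℕ) : ∃ (C : ℝ) (L : ℕ), 0 < C ∧ 1 ≤ L ∧ ∀ m : ℕ, 1 ≤ m → ∃ k : ℕ → ℝ → ℝ,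
    (∀ l, Continuous (k l)) ∧
    (∀ g, Continuous g → ∀ p : ℝ≥0∞, 1 ≤ p →
      eLpNorm (Qop k (L * m) g) p muI ≤ ENNReal.ofReal C * eLpNorm g p muI) ∧
    (∀ g, IsCh (q + 1) g → ∀ p : ℝ≥0∞, 1 ≤ p →
      eLpNorm (fun x => g 0 x - Qop k (L * m) (g 0) x) p muI ≤
        ENNReal.ofReal (C / m ^ (q + 1)) * eLpNorm (g (q + 1)) p muI) := by
  obtain ⟨w, B, hw, hd, hw0, hw1, hwB, hB⟩ := exists_bump
  obtain ⟨C0, L0, hC0, hL0⟩ := tpow_approx q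
  obtain ⟨C1, hC1, hS⟩ := SS_error (w 0) (hw 0) (B 0) (hB 0).le (hwB 0) (hw0 0) hw1 q
  have hcS := cS_nonneg (q + 1)
  have hB0 := hB 0
  have hBq := hB (q + 1)
  set K1 : ℝ := cS (q + 1) * (4 * B 0) with hK1
  set K2 : ℝ := C0 * (cS (q + 1) * (4 * B (q + 1) * (2 * (q + 1 : ℕ)) ^ (q + 1))) with hK2
  have hK1p : 0 ≤ K1 := by positivity
  have hK2p : 0 ≤ K2 := by positivity
  refine ⟨K1 + K2 + C1 + C0 * K1, L0 + q + 1, by positivity, by omega, fun m hm => ?_⟩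
  obtain ⟨P, hP, hE⟩ := hL0 m hm
  have hmR : (1 : ℝ) ≤ m := by exact_mod_cast hm
  have hm0 : (0 : ℝ) < m := by linarith
  set δ : ℝ := 1 / (2 * (q + 1 : ℕ) * m) with hδ
  have hδ0 : 0 < δ := by positivity
  have hδ2 : ((q + 1 : ℕ) : ℝ) * δ ≤ 1 / 2 := by
    rw [hδ]
    rw [show ((q + 1 : ℕ) : ℝ) * (1 / (2 * (q + 1 : ℕ) * m)) = 1 / (2 * m) by field_simp]
    gcongr
    linarith
  obtain ⟨n, hn⟩ : ∃ n, (L0 + q + 1) * m = n + 1 :=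
    ⟨(L0 + q + 1) * m - 1, by have : 1 ≤ (L0 + q + 1) * m := Nat.mul_pos (by omega) hm
                              omega⟩
  have hn1 : P.natDegree ≤ n := by
    have : (L0 + q + 1) * m = L0 * m + q * m + m := by ring
    have h2 : q ≤ q * m := Nat.le_mul_of_pos_right _ hm
    omega
  have hn2 : q ≤ n := by
    have : (L0 + q + 1) * m = L0 * m + q * m + m := by ring
    have h2 : q ≤ q * m := Nat.le_mul_of_pos_right _ hm
    omega
  rw [hn]
  have hSc : ∀ g, Continuous g → Continuous (SS (w 0) (q + 1) δ g) := by
    intro g hg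
    rw [← Vop_zero]; exact Vop_cont w hw _ _ _ g hg
  refine ⟨kco w q δ P, kco_cont w hw q δ P, ?_, ?_⟩
  · intro g hg p hp
    have hQc := Qop_cont (kco w q δ P) (n + 1) g
    have e : Qop (kco w q δ P) (n + 1) g = SS (w 0) (q + 1) δ g -
        fun x => SS (w 0) (q + 1) δ g x - Qop (kco w q δ P) (n + 1) g x := by
      ext x; simp
    rw [e]
    have h1 := Vop_bound w B hw hw0 hwB hB (q + 1) δ hδ0 hδ2 0 g hg p hp
    rw [Vop_zero, pow_zero, div_one, ← hK1] at h1
    have h2 := Qdiff_bound w hw hd q δ P n hn1 hn2 _ hE g hg p hp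
    have h3 := Vop_bound w B hw hw0 hwB hB (q + 1) δ hδ0 hδ2 (q + 1) g hg p hp
    calc _ ≤ _ := eLpNorm_sub_le (hSc g hg).aestronglyMeasurable
          ((hSc g hg).sub hQc).aestronglyMeasurable hp
      _ ≤ ENNReal.ofReal K1 * eLpNorm g p muI + ENNReal.ofReal K2 * eLpNorm g p muI := by
          refine add_le_add h1 (h2.trans ?_)
          calc _ ≤ ENNReal.ofReal (C0 / m ^ (q + 1)) *
                (ENNReal.ofReal (cS (q + 1) * (4 * B (q + 1) / δ ^ (q + 1))) * eLpNorm g p muI) := by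
                gcongr
            _ = _ := by
                rw [← mul_assoc, ← ENNReal.ofReal_mul (by positivity)]
                congr 2
                rw [hK2, hδ, div_pow, one_pow, mul_pow _ (m : ℝ)]
                field_simp
      _ = ENNReal.ofReal (K1 + K2) * eLpNorm g p muI := by
          rw [← add_mul, ENNReal.ofReal_add hK1p hK2p]
      _ ≤ _ := by
          gcongr ENNReal.ofReal ?_ * _
          nlinarith [mul_nonneg hC0.le hK1p]
  · intro g hg p hp
    have hg0 := hg.1 0 (by omega)
    have hQc := Qop_cont (kco w q δ P) (n + 1) (g 0)
    have e : (fun x => g 0 x - Qop (kco w q δ P) (n + 1) (g 0) x) =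
        (fun x => g 0 x - SS (w 0) (q + 1) δ (g 0) x) +
        fun x => SS (w 0) (q + 1) δ (g 0) x - Qop (kco w q δ P) (n + 1) (g 0) x := by
      ext x; simp
    rw [e]
    have h1 := hS δ hδ0 hδ2 g hg p hp
    have h2 := Qdiff_bound w hw hd q δ P n hn1 hn2 _ hE (g 0) hg0 p hp
    have h3 := Vop_chain_bound w B hw hd hw0 hwB hB (q + 1) δ hδ0 hδ2 (q + 1) g hg p hp
    rw [← hK1] at h3
    calc _ ≤ _ := eLpNorm_add_le (hg0.sub (hSc _ hg0)).aestronglyMeasurable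
          ((hSc _ hg0).sub hQc).aestronglyMeasurable hp
      _ ≤ ENNReal.ofReal (C1 / m ^ (q + 1)) * eLpNorm (g (q + 1)) p muI +
          ENNReal.ofReal (C0 * K1 / m ^ (q + 1)) * eLpNorm (g (q + 1)) p muI := by
          refine add_le_add (h1.trans ?_) (h2.trans ?_)
          · gcongr
            rw [div_eq_mul_inv, ← inv_pow]
            gcongr
            rw [hδ, ← one_div]
            gcongr
            have : (1 : ℝ) ≤ (q + 1 : ℕ) := by exact_mod_cast Nat.le_add_left 1 q
            nlinarith
          · calc _ ≤ ENNReal.ofReal (C0 / m ^ (q + 1)) *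
                (ENNReal.ofReal K1 * eLpNorm (g (q + 1)) p muI) := by gcongr
              _ = _ := by
                rw [← mul_assoc, ← ENNReal.ofReal_mul (by positivity)]
                congr 2; ring
      _ = ENNReal.ofReal ((C1 + C0 * K1) / m ^ (q + 1)) * eLpNorm (g (q + 1)) p muI := by
          rw [← add_mul, ← ENNReal.ofReal_add (by positivity) (by positivity), add_div]
      _ ≤ _ := by
          gcongr
          linarith

noncomputable def muC (d : ℕ) : Measure (Fin d → ℝ) := volume.restrict (symCube d)

lemma muC_eq (d : ℕ) : muC d = Measure.pi (fun _ : Fin d => muI) := by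
  unfold muC muI symCube
  rw [volume_pi, Measure.restrict_pi_pi]

lemma measurableSet_symCube (d : ℕ) : MeasurableSet (symCube d) :=
  MeasurableSet.univ_pi fun _ => measurableSet_Icc

lemma muC_univ (d : ℕ) : muC d Set.univ = 2 ^ d := by
  rw [muC_eq, Measure.pi_univ]; simp [muI_univ]

instance (d : ℕ) : IsFiniteMeasure (muC d) := ⟨by rw [muC_univ]; simp⟩

lemma interior_symCube (d : ℕ) :
    interior (symCube d) = Set.univ.pi fun _ : Fin d => Set.Ioo (-1 : ℝ) 1 := by
  unfold symCube
  rw [interior_pi_set Set.finite_univ]; simp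

lemma symCube_sub_closure (d : ℕ) : symCube d ⊆ closure (interior (symCube d)) := by
  rw [interior_symCube, closure_pi_set, symCube]
  simp only [closure_Ioo (show (-1 : ℝ) ≠ 1 by norm_num)]
  exact subset_rfl

lemma update_mem_cube {d : ℕ} {x : Fin d → ℝ} (hx : x ∈ symCube d) (i : Fin d) {t : ℝ}
    (ht : t ∈ Set.Icc (-1 : ℝ) 1) : Function.update x i t ∈ symCube d := by
  intro j _
  by_cases h : j = i
  · subst h; simpa using ht
  · rw [Function.update_of_ne h]; exact hx j trivial

lemma slice_formula {d : ℕ} (i : Fin d) (H : (Fin d → ℝ) → ℝ≥0∞) (hH : Measurable H) :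
    ∫⁻ x, (∫⁻ t, H (Function.update x i t) ∂muI) ∂(muC d) = 2 * ∫⁻ x, H x ∂(muC d) := by
  have hm : Measurable fun x => ∫⁻ t, H (Function.update x i t) ∂muI := by
    refine Measurable.lintegral_prod_right' (f := fun z : (Fin d → ℝ) × ℝ => H (Function.update z.1 i z.2)) ?_
    exact hH.comp (by fun_prop)
  rw [← lintegral_const_mul _ hH, muC_eq]
  refine lintegral_eq_of_lmarginal_eq {i} hm (hH.const_mul 2) ?_
  funext x
  rw [lmarginal_singleton, lmarginal_singleton]
  simp only [Function.update_idem]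
  rw [lintegral_const, muI_univ, lintegral_const_mul' _ _ (by simp), mul_comm]

lemma slice_bound {d : ℕ} (i : Fin d) (F G : (Fin d → ℝ) → ℝ) (hF : Continuous F) (hG : Continuous G)
    (C : ℝ≥0∞) (hC : C ≠ ∞) (p : ℝ≥0∞) (hp : 1 ≤ p)
    (h : ∀ x ∈ symCube d, eLpNorm (fun t => F (Function.update x i t)) p muI ≤
      C * eLpNorm (fun t => G (Function.update x i t)) p muI) :
    eLpNorm F p (muC d) ≤ C * eLpNorm G p (muC d) := by
  rcases eq_or_ne p ∞ with rfl | hpt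
  · rw [eLpNorm_exponent_top (f := F)]
    refine eLpNormEssSup_le_of_ae_enorm_bound ?_
    refine (ae_restrict_iff' (measurableSet_symCube d)).2 (Filter.Eventually.of_forall fun x hx => ?_)
    have h1 := enorm_le_top_I (fun t => F (Function.update x i t))
      (by fun_prop) (x i) (hx i trivial)
    simp only [Function.update_eq_self] at h1
    refine h1.trans ((h x hx).trans ?_)
    gcongr
    rw [eLpNorm_exponent_top (μ := muI)]
    refine eLpNormEssSup_le_of_ae_enorm_bound ?_
    refine (ae_restrict_iff' measurableSet_Icc).2 (Filter.Eventually.of_forall fun t ht => ?_)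
    exact enorm_le_top_norm volume _ (symCube_sub_closure d) G hG.continuousOn _ (update_mem_cube hx i ht)
  · have hp0 : p ≠ 0 := (zero_lt_one.trans_le hp).ne'
    have hq0 : 0 < p.toReal := ENNReal.toReal_pos hp0 hpt
    have key : ∀ (F : (Fin d → ℝ) → ℝ), Continuous F → 2 * (eLpNorm F p (muC d)) ^ p.toReal =
        ∫⁻ x, (eLpNorm (fun t => F (Function.update x i t)) p muI) ^ p.toReal ∂(muC d) := by
      intro F hF
      have e : ∀ {X : Type} [MeasurableSpace X] (μ : Measure X) (f : X → ℝ),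
          (eLpNorm f p μ) ^ p.toReal = ∫⁻ x, ‖f x‖ₑ ^ p.toReal ∂μ := by
        intro X _ μ f
        rw [eLpNorm_eq_lintegral_rpow_enorm_toReal hp0 hpt, ← ENNReal.rpow_mul,
          one_div_mul_cancel hq0.ne', ENNReal.rpow_one]
      simp only [e]
      rw [slice_formula i (fun x => ‖F x‖ₑ ^ p.toReal)]
      exact hF.measurable.enorm.pow_const _
    have h2 : 2 * (eLpNorm F p (muC d)) ^ p.toReal ≤ 2 * (C * eLpNorm G p (muC d)) ^ p.toReal := by
      rw [ENNReal.mul_rpow_of_nonneg _ _ hq0.le, mul_left_comm, key F hF, key G hG,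
        ← lintegral_const_mul' _ _ (ENNReal.rpow_ne_top_of_nonneg hq0.le hC)]
      refine setLIntegral_mono' (measurableSet_symCube d) fun x hx => ?_
      rw [← ENNReal.mul_rpow_of_nonneg _ _ hq0.le]
      gcongr
      exact h x hx
    rw [ENNReal.mul_le_mul_iff_right (by simp) (by simp)] at h2
    exact (ENNReal.rpow_le_rpow_iff hq0).1 h2

lemma coef_cont {d : ℕ} (i : Fin d) (k : ℝ → ℝ) (hk : Continuous k) (F : (Fin d → ℝ) → ℝ)
    (hF : Continuous F) :
    Continuous fun x => ∫ z in (-1 : ℝ)..1, k z * F (Function.update x i z) := by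
  refine intervalIntegral.continuous_parametric_intervalIntegral_of_continuous' ?_ _ _
  simp only [Function.uncurry_def]
  fun_prop

noncomputable def Qi {d : ℕ} (k : ℕ → ℝ → ℝ) (N : ℕ) (i : Fin d) (F : (Fin d → ℝ) → ℝ) :
    (Fin d → ℝ) → ℝ := fun x => Qop k N (fun z => F (Function.update x i z)) (x i)

lemma Qi_cont {d : ℕ} (k : ℕ → ℝ → ℝ) (hk : ∀ l, Continuous (k l)) (N : ℕ) (i : Fin d)
    (F : (Fin d → ℝ) → ℝ) (hF : Continuous F) : Continuous (Qi k N i F) := by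
  unfold Qi Qop
  refine continuous_finsetSum _ fun l _ => ?_
  exact ((continuous_apply i).pow l).mul (coef_cont i (k l) (hk l) F hF)

lemma Qi_slice {d : ℕ} (k : ℕ → ℝ → ℝ) (N : ℕ) (i : Fin d) (F : (Fin d → ℝ) → ℝ) (x : Fin d → ℝ) :
    (fun t => Qi k N i F (Function.update x i t)) = Qop k N (fun z => F (Function.update x i z)) := by
  funext t
  simp [Qi]

lemma Qi_sub {d : ℕ} (k : ℕ → ℝ → ℝ) (hk : ∀ l, Continuous (k l)) (N : ℕ) (i : Fin d)
    (F G : (Fin d → ℝ) → ℝ) (hF : Continuous F) (hG : Continuous G) (x : Fin d → ℝ) :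
    Qi k N i (fun x => F x - G x) x = Qi k N i F x - Qi k N i G x := by
  unfold Qi Qop
  rw [← Finset.sum_sub_distrib]
  refine Finset.sum_congr rfl fun l _ => ?_
  rw [← mul_sub, ← intervalIntegral.integral_sub]
  · simp only [mul_sub]
  · exact ((hk l).mul (by fun_prop)).intervalIntegrable _ _
  · exact ((hk l).mul (by fun_prop)).intervalIntegrable _ _

noncomputable def TT {d : ℕ} (k : ℕ → ℝ → ℝ) (N : ℕ) : List (Fin d) → ((Fin d → ℝ) → ℝ) → (Fin d → ℝ) → ℝ
  | [], F => F
  | i :: l, F => Qi k N i (TT k N l F)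

lemma TT_cont {d : ℕ} (k : ℕ → ℝ → ℝ) (hk : ∀ l, Continuous (k l)) (N : ℕ) (l : List (Fin d))
    (F : (Fin d → ℝ) → ℝ) (hF : Continuous F) : Continuous (TT k N l F) := by
  induction l with
  | nil => exact hF
  | cons i l ih => exact Qi_cont k hk N i _ ih

noncomputable def Kc (C : ℝ) : ℕ → ℝ
  | 0 => 0
  | n + 1 => C + C * Kc C n

lemma Kc_nonneg (C : ℝ) (hC : 0 ≤ C) (n : ℕ) : 0 ≤ Kc C n := by
  induction n with
  | zero => exact le_rfl
  | succ n ih => simp only [Kc]; positivity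

lemma TT_error {d : ℕ} (k : ℕ → ℝ → ℝ) (hk : ∀ l, Continuous (k l)) (N q m : ℕ) (C : ℝ) (hC : 0 < C)
    (p : ℝ≥0∞) (hp : 1 ≤ p)
    (h1 : ∀ g, Continuous g → eLpNorm (Qop k N g) p muI ≤ ENNReal.ofReal C * eLpNorm g p muI)
    (h2 : ∀ g, IsCh (q + 1) g → eLpNorm (fun x => g 0 x - Qop k N (g 0) x) p muI ≤
        ENNReal.ofReal (C / m ^ (q + 1)) * eLpNorm (g (q + 1)) p muI)
    (F : (Fin d → ℝ) → ℝ) (hF : Continuous F) (D : Fin d → (Fin d → ℝ) → ℝ)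
    (hD : ∀ i, Continuous (D i)) (S : ℝ≥0∞) (hS : ∀ i, eLpNorm (D i) p (muC d) ≤ S)
    (hch : ∀ i, ∀ x ∈ symCube d, ∃ g, IsCh (q + 1) g ∧ (∀ t, g 0 t = F (Function.update x i t)) ∧
      ∀ t, g (q + 1) t = D i (Function.update x i t)) (l : List (Fin d)) :
    eLpNorm (fun x => F x - TT k N l F x) p (muC d) ≤
      ENNReal.ofReal (Kc C l.length / m ^ (q + 1)) * S := by
  induction l with
  | nil => simp [TT]
  | cons i l ih =>
    have hT := TT_cont k hk N l F hF
    have e : (fun x => F x - TT k N (i :: l) F x) =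
        (fun x => F x - Qi k N i F x) + (Qi k N i (fun x => F x - TT k N l F x)) := by
      funext x
      simp only [TT, Pi.add_apply]
      rw [Qi_sub k hk N i F _ hF hT]; ring
    rw [e]
    have hc1 : Continuous (fun x => F x - Qi k N i F x) := hF.sub (Qi_cont k hk N i F hF)
    have hc2 : Continuous (Qi k N i (fun x => F x - TT k N l F x)) := Qi_cont k hk N i _ (hF.sub hT)
    refine (eLpNorm_add_le hc1.aestronglyMeasurable hc2.aestronglyMeasurable hp).trans ?_
    have b1 : eLpNorm (fun x => F x - Qi k N i F x) p (muC d) ≤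
        ENNReal.ofReal (C / m ^ (q + 1)) * eLpNorm (D i) p (muC d) := by
      refine slice_bound i _ _ hc1 (hD i) _ ENNReal.ofReal_ne_top p hp fun x hx => ?_
      obtain ⟨g, hg, hg0, hg1⟩ := hch i x hx
      have := h2 g hg
      rw [show g 0 = fun t => F (Function.update x i t) from funext hg0,
        show g (q + 1) = fun t => D i (Function.update x i t) from funext hg1, ← Qi_slice] at this
      exact this
    have b2 : eLpNorm (Qi k N i (fun x => F x - TT k N l F x)) p (muC d) ≤
        ENNReal.ofReal C * eLpNorm (fun x => F x - TT k N l F x) p (muC d) := by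
      refine slice_bound i _ _ hc2 (hF.sub hT) _ ENNReal.ofReal_ne_top p hp fun x hx => ?_
      rw [Qi_slice]
      exact h1 _ (by fun_prop)
    have hK := Kc_nonneg C hC.le l.length
    calc _ ≤ ENNReal.ofReal (C / m ^ (q + 1)) * S + ENNReal.ofReal C *
          (ENNReal.ofReal (Kc C l.length / m ^ (q + 1)) * S) := by
          refine add_le_add (b1.trans ?_) (b2.trans ?_)
          · gcongr; exact hS i
          · gcongr
      _ = _ := by
        rw [← mul_assoc, ← ENNReal.ofReal_mul hC.le, ← add_mul, ← ENNReal.ofReal_add (by positivity) (by positivity)]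
        congr 2
        simp only [List.length_cons, Kc]; ring

lemma const_of_update {d : ℕ} (c : (Fin d → ℝ) → ℝ) (h : ∀ i x t, c (Function.update x i t) = c x)
    (x y : Fin d → ℝ) : c x = c y := by
  have : ∀ s : Finset (Fin d), c (s.piecewise x y) = c y := by
    intro s
    induction s using Finset.induction_on with
    | empty => simp
    | insert i s hi ih => rw [Finset.piecewise_insert, h, ih]
  simpa using this Finset.univ

lemma coef_bound {d : ℕ} (i : Fin d) (k : ℝ → ℝ) (hk : Continuous k) (B : ℝ) (hB : 0 ≤ B)
    (hkB : ∀ z ∈ Set.Icc (-1 : ℝ) 1, |k z| ≤ B) (F : (Fin d → ℝ) → ℝ)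
    (hF : Continuous F) (p : ℝ≥0∞) (hp : 1 ≤ p) :
    eLpNorm (fun x => ∫ z in (-1 : ℝ)..1, k z * F (Function.update x i z)) p (muC d) ≤
      ENNReal.ofReal (2 * B) * eLpNorm F p (muC d) := by
  refine slice_bound i _ _ (coef_cont i k hk F hF) hF _ ENNReal.ofReal_ne_top p hp fun x _ => ?_
  have hc : ∀ y ∈ Set.Icc (-1 : ℝ) 1, ∫⁻ _, ENNReal.ofReal B ∂muI ≤ ENNReal.ofReal (2 * B) := by
    intro _ _
    rw [lintegral_const, muI_univ, ENNReal.ofReal_mul (by norm_num), mul_comm]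
    simp
  refine schur_kernel (fun _ _ => ENNReal.ofReal B) _ _ _ ENNReal.ofReal_ne_top (by fun_prop)
    measurable_const hc hc ?_ p hp
  intro t _
  simp only [Function.update_idem]
  refine (enorm_intervalIntegral_le _ (by norm_num)).trans ?_
  refine setLIntegral_mono' measurableSet_Icc fun z hz => ?_
  rw [enorm_mul]
  gcongr
  rw [← ofReal_norm]
  exact ENNReal.ofReal_le_ofReal (hkB z hz)

lemma TT_struct {d : ℕ} (k : ℕ → ℝ → ℝ) (hk : ∀ l, Continuous (k l)) (N : ℕ) (hN : 1 ≤ N)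
    (l : List (Fin d)) (hl : l.Nodup) :
    ∃ (ι : Type) (_ : Fintype ι) (e : ι → Fin d → ℕ) (M : ℝ), 0 ≤ M ∧ (∀ a i, e a i < N) ∧
      (∀ a, ∀ i, i ∉ l → e a i = 0) ∧ ∀ F : (Fin d → ℝ) → ℝ, Continuous F →
      ∃ c : ι → (Fin d → ℝ) → ℝ, (∀ a, Continuous (c a)) ∧
        (∀ a, ∀ i ∈ l, ∀ x t, c a (Function.update x i t) = c a x) ∧
        (∀ a, ∀ p : ℝ≥0∞, 1 ≤ p → eLpNorm (c a) p (muC d) ≤ ENNReal.ofReal M * eLpNorm F p (muC d)) ∧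
        ∀ x, TT k N l F x = ∑ a, (∏ j, x j ^ e a j) * c a x := by
  have hkB : ∃ B : ℝ, 0 ≤ B ∧ ∀ j < N, ∀ z ∈ Set.Icc (-1 : ℝ) 1, |k j z| ≤ B := by
    have : ∀ j, ∃ B : ℝ, ∀ z ∈ Set.Icc (-1 : ℝ) 1, |k j z| ≤ B := fun j => by
      obtain ⟨B, hB⟩ := isCompact_Icc.exists_bound_of_continuousOn (hk j).continuousOn (s := Set.Icc (-1 : ℝ) 1)
      exact ⟨B, hB⟩
    choose B hB using this
    refine ⟨∑ j ∈ Finset.range N, |B j|, by positivity, fun j hj z hz => ?_⟩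
    refine (hB j z hz).trans ((le_abs_self _).trans ?_)
    exact Finset.single_le_sum (f := fun j => |B j|) (fun _ _ => abs_nonneg _) (Finset.mem_range.2 hj)
  obtain ⟨B, hB0, hB⟩ := hkB
  induction l with
  | nil =>
    refine ⟨Unit, inferInstance, fun _ _ => 0, 1, by norm_num, fun _ _ => hN, fun _ _ _ => rfl, fun F hF =>
      ⟨fun _ => F, fun _ => hF, by simp, by simp, by simp [TT]⟩⟩
  | cons i l ih =>
    rw [List.nodup_cons] at hl
    obtain ⟨ι, fι, e, M, hM, he, he0, H⟩ := ih hl.2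
    refine ⟨Fin N × ι, inferInstance, fun a s => e a.2 s + (Pi.single i (a.1 : ℕ) : Fin d → ℕ) s, 2 * B * M,
      by positivity, ?_, ?_, ?_⟩
    · rintro ⟨j, a⟩ s
      by_cases h : s = i
      · subst h; simp [he0 a s hl.1]
      · simpa [h] using he a s
    · rintro ⟨j, a⟩ s hs
      simp only [List.mem_cons, not_or] at hs
      simp [hs.1, he0 a s hs.2]
    · intro F hF
      obtain ⟨c, hc, hci, hcp, hcT⟩ := H F hF
      refine ⟨fun a x => ∫ z in (-1 : ℝ)..1, k a.1 z * c a.2 (Function.update x i z), ?_, ?_, ?_, ?_⟩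
      · rintro ⟨j, a⟩
        exact coef_cont i _ (hk j) _ (hc a)
      · rintro ⟨j, a⟩ s hs x t
        rcases eq_or_ne s i with rfl | hsi
        · simp
        · have hs' : s ∈ l := by simpa [hsi] using hs
          simp only [Function.update_comm hsi, hci a s hs']
      · rintro ⟨j, a⟩ p hp
        refine (coef_bound i _ (hk j) B hB0 (hB j j.2) _ (hc a) p hp).trans ?_
        rw [ENNReal.ofReal_mul (p := 2 * B) (by positivity), mul_assoc]
        gcongr
        exact hcp a p hp
      · intro x
        simp only [TT, Qi, Qop]
        have hx : ∀ a z, ∏ s, (Function.update x i z s) ^ e a s = ∏ s, x s ^ e a s := by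
          intro a z
          refine Finset.prod_congr rfl fun s _ => ?_
          by_cases h : s = i
          · subst h; simp [he0 a s hl.1]
          · rw [Function.update_of_ne h]
        have hpr : ∀ (a : ι) (j : ℕ), ∏ s, x s ^ (e a s + (Pi.single i j : Fin d → ℕ) s) =
            x i ^ j * ∏ s, x s ^ e a s := by
          intro a j
          simp only [pow_add]
          rw [Finset.prod_mul_distrib, mul_comm]
          congr 1
          rw [Finset.prod_eq_single i]
          · simp
          · intro s _ hs; simp [hs]
          · simp
        rw [Fintype.sum_prod_type, Finset.sum_range]
        refine Finset.sum_congr rfl fun j _ => ?_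
        simp only [hpr, hcT, hx]
        simp only [mul_assoc]
        rw [← Finset.mul_sum]
        congr 1
        simp only [Finset.mul_sum]
        rw [intervalIntegral.integral_finsetSum]
        · refine Finset.sum_congr rfl fun a _ => ?_
          rw [← intervalIntegral.integral_const_mul]
          congr 1; funext z; ring
        · intro a _
          have := hc a
          have := hk j
          exact Continuous.intervalIntegrable (by fun_prop) _ _

lemma TT_final {d : ℕ} (k : ℕ → ℝ → ℝ) (hk : ∀ l, Continuous (k l)) (N : ℕ) (hN : 1 ≤ N) :
    ∃ (ι : Type) (_ : Fintype ι) (e : ι → Fin d → ℕ) (M : ℝ), 0 ≤ M ∧ (∀ a i, e a i < N) ∧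
      ∀ F : (Fin d → ℝ) → ℝ, Continuous F → 
      ∃ c : ι → ℝ, 
        (∀ a, ∀ p : ℝ≥0∞, 1 ≤ p → ‖c a‖ₑ ≤ ENNReal.ofReal M * eLpNorm F p (muC d)) ∧
        ∀ x, TT k N (List.finRange d) F x = ∑ a, (∏ j, x j ^ e a j) * c a := by
  obtain ⟨ι, fι, e, M, hM, he, he0, H⟩ := TT_struct k hk N hN (List.finRange d) (List.nodup_finRange d)
  refine ⟨ι, fι, e, M, hM, he, fun F hF => ?_⟩
  obtain ⟨c, hc, hci, hcp, hcT⟩ := H F hF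
  have hconst : ∀ a x, c a x = c a 0 := fun a x => 
    const_of_update (c a) (fun i x t => hci a i (List.mem_finRange i) x t) x 0
  refine ⟨fun a => c a 0, fun a p hp => ?_, fun x => ?_⟩
  · refine le_trans ?_ (hcp a p hp)
    rw [show c a = fun _ => c a 0 from funext (hconst a), eLpNorm_const _ (zero_lt_one.trans_le hp).ne' , muC_univ]
    · refine le_mul_of_one_le_right' ?_
      rw [← ENNReal.rpow_zero (x := (2 : ℝ≥0∞) ^ d)]
      exact ENNReal.rpow_le_rpow_of_exponent_le (one_le_pow₀ (by norm_num)) (by positivity)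
    · intro h
      have := muC_univ d
      rw [h] at this
      simp only [Measure.coe_zero, Pi.zero_apply] at this
      exact (pow_ne_zero d (by norm_num : (2 : ℝ≥0∞) ≠ 0)) this.symm
  · rw [hcT]
    simp only [hconst _ x]

noncomputable def clampC {d : ℕ} (x : Fin d → ℝ) : Fin d → ℝ := fun i => max (-1) (min 1 (x i))

lemma clampC_cont {d : ℕ} : Continuous (clampC (d := d)) := by
  unfold clampC; fun_prop

lemma clampC_mem {d : ℕ} (x : Fin d → ℝ) : clampC x ∈ symCube d := by
  intro i _
  exact ⟨le_max_left _ _, max_le (by norm_num) (min_le_left _ _)⟩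

lemma clampC_eq {d : ℕ} {x : Fin d → ℝ} (hx : x ∈ symCube d) : clampC x = x := by
  funext i
  have := hx i trivial
  simp only [clampC]
  rw [min_eq_right this.2, max_eq_right this.1]

lemma convex_symCube (d : ℕ) : Convex ℝ (symCube d) := convex_pi fun _ _ => convex_Icc _ _

lemma uniqueDiff_symCube (d : ℕ) : UniqueDiffOn ℝ (symCube d) := by
  refine uniqueDiffOn_convex (convex_symCube d) ⟨0, ?_⟩
  rw [interior_symCube]
  intro i _
  simp

lemma ae_interior (d : ℕ) : ∀ᵐ x ∂(muC d), x ∈ interior (symCube d) := by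
  unfold muC
  rw [ae_restrict_iff' (measurableSet_symCube d)]
  have h := (convex_symCube d).addHaar_frontier volume
  filter_upwards [compl_mem_ae_iff.2 h] with x hx hxc
  by_contra hni
  exact hx ⟨subset_closure hxc, hni⟩

noncomputable def Gd {d : ℕ} (f : (Fin d → ℝ) → ℝ) (i : Fin d) (j : ℕ) (x : Fin d → ℝ) : ℝ :=
  iteratedFDerivWithin ℝ j f (symCube d) (clampC x) (fun _ => Pi.single i 1)

lemma Gd_cont {d r : ℕ} (f : (Fin d → ℝ) → ℝ) (hf : ContDiffOn ℝ r f (symCube d)) (i : Fin d) (j : ℕ)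
    (hj : j ≤ r) : Continuous (Gd f i j) := by
  have h := hf.continuousOn_iteratedFDerivWithin (m := j) (by exact_mod_cast hj) (uniqueDiff_symCube d)
  have h2 : Continuous fun x => iteratedFDerivWithin ℝ j f (symCube d) (clampC x) :=
    h.comp_continuous clampC_cont clampC_mem
  exact (ContinuousMultilinearMap.apply ℝ (fun _ : Fin j => Fin d → ℝ) ℝ
    (fun _ => Pi.single i 1)).continuous.comp h2

lemma Gd_fderiv {d r : ℕ} (f : (Fin d → ℝ) → ℝ) (hf : ContDiffOn ℝ r f (symCube d)) (i : Fin d) (j : ℕ)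
    (hj : j < r) (x : Fin d → ℝ) (hx : x ∈ symCube d) :
    ∃ L : (Fin d → ℝ) →L[ℝ] ℝ, HasFDerivWithinAt
      (fun y => iteratedFDerivWithin ℝ j f (symCube d) y (fun _ => Pi.single i 1)) L (symCube d) x ∧
      L (Pi.single i 1) = Gd f i (j + 1) x := by
  have h := (hf.differentiableOn_iteratedFDerivWithin (m := j) (by exact_mod_cast hj)
    (uniqueDiff_symCube d) x hx).hasFDerivWithinAt
  have h2 := (ContinuousMultilinearMap.apply ℝ (fun _ : Fin j => Fin d → ℝ) ℝ
    (fun _ => Pi.single i 1)).hasFDerivAt.comp_hasFDerivWithinAt x h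
  refine ⟨_, h2, ?_⟩
  rw [Gd, clampC_eq hx, iteratedFDerivWithin_succ_apply_left]
  rfl

lemma Gd_chain {d r : ℕ} (f : (Fin d → ℝ) → ℝ) (hf : ContDiffOn ℝ r f (symCube d)) (i : Fin d)
    (x : Fin d → ℝ) (hx : x ∈ symCube d) :
    IsCh r (fun j t => Gd f i j (Function.update x i t)) := by
  refine ⟨fun j hj => (Gd_cont f hf i j hj).comp (by fun_prop), fun j hj t ht => ?_⟩
  have htI : t ∈ Set.Icc (-1 : ℝ) 1 := Set.Ioo_subset_Icc_self ht
  obtain ⟨L, hL, hL2⟩ := Gd_fderiv f hf i j hj _ (update_mem_cube hx i htI)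
  have hu : HasDerivAt (Function.update x i) (Pi.single i 1) t := hasDerivAt_update x i t
  have h := hL.comp_hasDerivWithinAt t (hu.hasDerivWithinAt (s := Set.Icc (-1) 1))
    (fun s hs => update_mem_cube hx i hs)
  have h3 := h.hasDerivAt (Icc_mem_nhds ht.1 ht.2)
  rw [hL2] at h3
  refine h3.congr_of_eventuallyEq ?_
  filter_upwards [Icc_mem_nhds ht.1 ht.2] with s hs
  simp only [Gd, Function.comp]
  rw [clampC_eq (update_mem_cube hx i hs)]

lemma Gd_partial {d r : ℕ} (f : (Fin d → ℝ) → ℝ) (hf : ContDiffOn ℝ r f (symCube d)) (i : Fin d) (j : ℕ)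
    (hj : j ≤ r) : ∀ x ∈ interior (symCube d), (partialDeriv i)^[j] f x = Gd f i j x := by
  induction j with
  | zero =>
    intro x hx
    simp [Gd, clampC_eq (interior_subset hx)]
  | succ j ih =>
    intro x hx
    rw [Function.iterate_succ_apply']
    obtain ⟨L, hL, hL2⟩ := Gd_fderiv f hf i j (by omega) x (interior_subset hx)
    have hLd := hL.hasFDerivAt (mem_interior_iff_mem_nhds.1 hx)
    have e : (partialDeriv i)^[j] f =ᶠ[nhds x]
        (fun y => iteratedFDerivWithin ℝ j f (symCube d) y (fun _ => Pi.single i 1)) := by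
      filter_upwards [isOpen_interior.mem_nhds hx] with y hy
      rw [ih (by omega) y hy, Gd, clampC_eq (interior_subset hy)]
    rw [partialDeriv, e.fderiv_eq, hLd.fderiv, hL2]

lemma multiPartial_single {d : ℕ} (i : Fin d) (r : ℕ) (f : (Fin d → ℝ) → ℝ) :
    multiPartial (Pi.single i r) f = (partialDeriv i)^[r] f := by
  have : ∀ l : List (Fin d), l.Nodup →
      l.foldr (fun j G => (partialDeriv j)^[(Pi.single i r : Fin d → ℕ) j] G) f =
      if i ∈ l then (partialDeriv i)^[r] f else f := by
    intro l hl
    induction l with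
    | nil => simp
    | cons a l ih =>
      rw [List.nodup_cons] at hl
      rw [List.foldr_cons, ih hl.2]
      by_cases h : a = i
      · subst h
        simp [hl.1]
      · have h' : i ≠ a := fun h' => h h'.symm
        simp [h, h']
  rw [multiPartial, this _ (List.nodup_finRange d), if_pos (List.mem_finRange i)]

lemma le_sobolev {d r : ℕ} (p : ℝ≥0∞) (f : (Fin d → ℝ) → ℝ) (k : Fin d → ℕ) (hk : ∑ j, k j ≤ r) :
    lpNormOnCube d p (multiPartial k f) ≤ sobolevNorm d r p f := by
  unfold sobolevNorm
  refine Finset.single_le_sum (f := fun k => lpNormOnCube d p (multiPartial k f)) (fun _ _ => zero_le) ?_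
  simp only [Finset.mem_filter, Fintype.mem_piFinset, Finset.mem_range]
  refine ⟨fun j => ?_, hk⟩
  have := Finset.single_le_sum (f := k) (fun _ _ => Nat.zero_le _) (Finset.mem_univ j)
  omega

lemma Gd_norm_le {d r : ℕ} (p : ℝ≥0∞) (f : (Fin d → ℝ) → ℝ) (hf : ContDiffOn ℝ r f (symCube d)) (i : Fin d)
    (j : ℕ) (hj : j ≤ r) : eLpNorm (Gd f i j) p (muC d) ≤ sobolevNorm d r p f := by
  have h := le_sobolev (r := r) p f (Pi.single i j) (by simpa using hj)
  refine le_trans (le_of_eq ?_) h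
  unfold lpNormOnCube
  rw [multiPartial_single]
  refine eLpNorm_congr_ae ?_
  filter_upwards [ae_interior d] with x hx
  exact (Gd_partial f hf i j hj x hx).symm

lemma ddim (d q : ℕ) (hd : 1 ≤ d) : ∃ (C : ℝ) (L : ℕ), 0 < C ∧ 1 ≤ L ∧ ∀ m : ℕ, 1 ≤ m →
    ∃ (ι : Type) (_ : Fintype ι) (e : ι → Fin d → ℕ) (M : ℝ), 0 ≤ M ∧ (∀ a i, e a i < L * m) ∧
      ∀ f : (Fin d → ℝ) → ℝ, ContDiffOn ℝ (q + 1 : ℕ) f (symCube d) → ∀ p : ℝ≥0∞, 1 ≤ p →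
      ∃ c : ι → ℝ,
        (∀ a, ‖c a‖ₑ ≤ ENNReal.ofReal M * sobolevNorm d (q + 1) p f) ∧
        lpNormOnCube d p (fun x => f x - ∑ a, (∏ j, x j ^ e a j) * c a) ≤
          ENNReal.ofReal (C / m ^ (q + 1)) * sobolevNorm d (q + 1) p f := by
  obtain ⟨C, L, hC, hL, H⟩ := oneD q
  refine ⟨Kc C d + 1, L, by have := Kc_nonneg C hC.le d; positivity, hL, fun m hm => ?_⟩
  obtain ⟨k, hk, h1, h2⟩ := H m hm
  obtain ⟨ι, fι, e, M, hM, he, hF⟩ := TT_final (d := d) k hk (L * m) (Nat.mul_pos hL hm)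
  refine ⟨ι, fι, e, M, hM, he, fun f hf p hp => ?_⟩
  set i0 : Fin d := ⟨0, hd⟩
  set F : (Fin d → ℝ) → ℝ := Gd f i0 0 with hFdef
  have hFc : Continuous F := Gd_cont f hf i0 0 (Nat.zero_le _)
  have hFe : ∀ i x, Gd f i 0 x = F x := fun i x => by simp [hFdef, Gd]
  obtain ⟨c, hc, hcT⟩ := hF F hFc
  refine ⟨c, fun a => (hc a p hp).trans ?_, ?_⟩
  · gcongr
    exact Gd_norm_le p f hf i0 0 (Nat.zero_le _)
  · have herr := TT_error k hk (L * m) q m C hC p hp (fun g hg => h1 g hg p hp) (fun g hg => h2 g hg p hp)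
      F hFc (fun i => Gd f i (q + 1)) (fun i => Gd_cont f hf i _ le_rfl) (sobolevNorm d (q + 1) p f)
      (fun i => Gd_norm_le p f hf i _ le_rfl)
      (fun i x hx => ⟨_, Gd_chain f hf i x hx, fun t => hFe i _, fun t => rfl⟩) (List.finRange d)
    rw [List.length_finRange] at herr
    have e1 : lpNormOnCube d p (fun x => f x - ∑ a, (∏ j, x j ^ e a j) * c a) =
        eLpNorm (fun x => F x - TT k (L * m) (List.finRange d) F x) p (muC d) := by
      refine eLpNorm_congr_ae ?_
      refine (ae_restrict_iff' (measurableSet_symCube d)).2 (Filter.Eventually.of_forall fun x hx => ?_)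
      simp only
      rw [hcT]
      simp [hFdef, Gd, clampC_eq hx]
    rw [e1]
    refine herr.trans ?_
    gcongr
    linarith

noncomputable def wt (k j : ℕ) : ℝ := (-1 : ℝ) ^ (k - j) * k.choose j

lemma wt_sum (k N α : ℕ) (hk : k < N) :
    ∑ j : Fin N, wt k j * ((j : ℕ) : ℝ) ^ α =
      ∑ j ∈ Finset.range (k + 1), ((-1 : ℤ) ^ (k - j) * k.choose j) • ((0 : ℝ) + j • (1 : ℝ)) ^ α := by
  rw [← Finset.sum_range (fun j => wt k j * (j : ℝ) ^ α)]
  rw [← Finset.sum_subset (Finset.range_subset_range.2 (Nat.succ_le_of_lt hk))]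
  · refine Finset.sum_congr rfl fun j _ => ?_
    simp [wt]
  · intro j _ hj
    have : k < j := by
      simp only [Finset.mem_range] at hj; omega
    simp [wt, Nat.choose_eq_zero_of_lt this]

lemma wt_lt (k N α : ℕ) (hk : k < N) (h : α < k) :
    ∑ j : Fin N, wt k j * ((j : ℕ) : ℝ) ^ α = 0 := by
  have e := congrFun (fwdDiff_iter_pow_eq_zero_of_lt (R := ℝ) h) 0
  rw [fwdDiff_iter_eq_sum_shift] at e
  rw [wt_sum k N α hk, e]; rfl

lemma wt_eq (k N : ℕ) (hk : k < N) :
    ∑ j : Fin N, wt k j * ((j : ℕ) : ℝ) ^ k = k.factorial := by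
  have e := congrFun (fwdDiff_iter_eq_factorial (R := ℝ) (n := k)) 0
  rw [fwdDiff_iter_eq_sum_shift] at e
  rw [wt_sum k N k hk, e]; simp

lemma W_expand {d : ℕ} (N : ℕ) (k : Fin d → ℕ) (x : Fin d → ℝ) (s : ℕ) :
    ∑ j : Fin d → Fin N, (∏ i, wt (k i) (j i)) * (∑ i, ((j i : ℕ) : ℝ) * x i) ^ s =
      ∑ α ∈ Finset.piAntidiag Finset.univ s, (Nat.multinomial Finset.univ α : ℝ) *
        ∏ i, ((∑ j : Fin N, wt (k i) j * ((j : ℕ) : ℝ) ^ α i) * x i ^ α i) := by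
  simp only [Finset.sum_pow_eq_sum_piAntidiag, Finset.mul_sum]
  rw [Finset.sum_comm]
  refine Finset.sum_congr rfl fun α _ => ?_
  simp only [Finset.sum_mul]
  rw [Finset.prod_univ_sum]
  rw [Finset.mul_sum, Fintype.piFinset_univ]
  refine Finset.sum_congr rfl fun j _ => ?_
  rw [mul_left_comm, ← Finset.prod_mul_distrib]
  congr 1
  refine Finset.prod_congr rfl fun i _ => ?_
  rw [mul_pow]; ring

lemma W_lt {d : ℕ} (N : ℕ) (k : Fin d → ℕ) (hk : ∀ i, k i < N) (x : Fin d → ℝ) (s : ℕ) (hs : s < ∑ i, k i) :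
    ∑ j : Fin d → Fin N, (∏ i, wt (k i) (j i)) * (∑ i, ((j i : ℕ) : ℝ) * x i) ^ s = 0 := by
  rw [W_expand]
  refine Finset.sum_eq_zero fun α hα => ?_
  rw [Finset.mem_piAntidiag] at hα
  obtain ⟨i, hi⟩ : ∃ i, α i < k i := by
    by_contra! hcon
    have := Finset.sum_le_sum fun i (_ : i ∈ Finset.univ) => hcon i
    have h1 : ∑ i, α i = s := hα.1
    omega
  rw [Finset.prod_eq_zero (Finset.mem_univ i), mul_zero]
  rw [wt_lt _ _ _ (hk i) hi, zero_mul]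

lemma W_eq {d : ℕ} (N : ℕ) (k : Fin d → ℕ) (hk : ∀ i, k i < N) (x : Fin d → ℝ) :
    ∑ j : Fin d → Fin N, (∏ i, wt (k i) (j i)) * (∑ i, ((j i : ℕ) : ℝ) * x i) ^ (∑ i, k i) =
      (∑ i, k i).factorial * ∏ i, x i ^ k i := by
  rw [W_expand, Finset.sum_eq_single k]
  · rw [Finset.prod_mul_distrib]
    simp only [fun i => wt_eq (k i) N (hk i)]
    rw [← mul_assoc]
    congr 1
    rw [← Nat.multinomial_spec Finset.univ k]
    push_cast; ring
  · intro α hα hne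
    rw [Finset.mem_piAntidiag] at hα
    obtain ⟨i, hi⟩ : ∃ i, α i < k i := by
      by_contra! hcon
      refine hne (funext fun i => ?_)
      have h1 : ∀ i ∈ Finset.univ, k i ≤ α i := fun i _ => hcon i
      exact ((Finset.sum_eq_sum_iff_of_le h1).1 hα.1.symm i (Finset.mem_univ i)).symm
    rw [Finset.prod_eq_zero (Finset.mem_univ i), mul_zero]
    rw [wt_lt _ _ _ (hk i) hi, zero_mul]
  · intro h
    exact absurd (Finset.mem_piAntidiag.2 ⟨rfl, by simp⟩) h

lemma chain_taylor0 (ρ : ℝ) (hρ : 0 < ρ) (n : ℕ) : ∀ (s : ℕ → ℝ → ℝ),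
    (∀ k t, |t| < ρ → HasDerivAt (s k) (s (k + 1) t) t) →
    ∃ K δ : ℝ, 0 ≤ K ∧ 0 < δ ∧ δ < ρ ∧ ∀ u, |u| ≤ δ →
      |s 0 u - ∑ i ∈ Finset.range n, s i 0 / i.factorial * u ^ i| ≤ K * |u| ^ n := by
  induction n with
  | zero =>
    intro s hs
    have hc : ContinuousOn (s 0) (Set.Icc (-(ρ / 2)) (ρ / 2)) := fun t ht =>
      (hs 0 t (by rw [abs_lt]; constructor <;> linarith [ht.1, ht.2])).continuousAt.continuousWithinAt
    obtain ⟨K, hK⟩ := isCompact_Icc.exists_bound_of_continuousOn hc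
    refine ⟨|K|, ρ / 2, abs_nonneg _, by positivity, by linarith, fun u hu => ?_⟩
    simp only [Finset.range_zero, Finset.sum_empty, sub_zero, pow_zero, mul_one]
    exact (hK u (abs_le.1 hu)).trans (le_abs_self _)
  | succ n ih =>
    intro s hs
    obtain ⟨K, δ, hK, hδ, hδρ, h⟩ := ih (fun k => s (k + 1)) (fun k t ht => hs (k + 1) t ht)
    refine ⟨K, δ, hK, hδ, hδρ, fun u hu => ?_⟩
    set D : ℝ → ℝ := fun u => s 0 u - ∑ i ∈ Finset.range (n + 1), s i 0 / i.factorial * u ^ i with hD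
    have hder : ∀ t, |t| ≤ |u| → HasDerivAt D
        (s 1 t - ∑ i ∈ Finset.range n, s (i + 1) 0 / i.factorial * t ^ i) t := by
      intro t ht
      refine (hs 0 t (by linarith)).sub ?_
      have h1 : ∀ i ∈ Finset.range (n + 1), HasDerivAt (fun u : ℝ => s i 0 / i.factorial * u ^ i)
          (s i 0 / i.factorial * (i * t ^ (i - 1))) t := fun i _ => (hasDerivAt_pow i t).const_mul _
      have h2 := HasDerivAt.fun_sum h1
      refine h2.congr_deriv ?_
      rw [Finset.sum_range_succ']
      simp only [Nat.cast_zero, zero_mul, mul_zero, add_zero, Nat.add_sub_cancel]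
      refine Finset.sum_congr rfl fun i _ => ?_
      rw [Nat.factorial_succ]
      push_cast
      have : (i.factorial : ℝ) ≠ 0 := by exact_mod_cast i.factorial_ne_zero
      field_simp
    have hb := (convex_Icc (-|u|) |u|).norm_image_sub_le_of_norm_hasDerivWithin_le (f := D)
      (f' := fun t => s 1 t - ∑ i ∈ Finset.range n, s (i + 1) 0 / i.factorial * t ^ i)
      (C := K * |u| ^ n) (x := 0) (y := u)
      (fun t ht => (hder t (abs_le.2 ht)).hasDerivWithinAt)
      (fun t ht => by
        have ht' := abs_le.2 ht
        refine (h t (ht'.trans hu)).trans ?_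
        gcongr)
      ⟨by simp, by simp⟩ (abs_le.1 le_rfl)
    have hD0 : D 0 = 0 := by
      simp only [hD]
      rw [Finset.sum_range_succ']
      simp
    rw [hD0, sub_zero, sub_zero, Real.norm_eq_abs, Real.norm_eq_abs] at hb
    rw [pow_succ, ← mul_assoc]
    exact hb

lemma dot_bound {d N : ℕ} (j : Fin d → Fin N) (x : Fin d → ℝ) (hx : x ∈ symCube d) :
    |∑ i, ((j i : ℕ) : ℝ) * x i| ≤ d * N := by
  refine (Finset.abs_sum_le_sum_abs _ _).trans ?_
  calc _ ≤ ∑ _i : Fin d, (N : ℝ) := by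
        refine Finset.sum_le_sum fun i _ => ?_
        rw [abs_mul]
        have h1 : |((j i : ℕ) : ℝ)| ≤ N := by
          rw [abs_of_nonneg (by positivity)]
          exact_mod_cast (j i).2.le
        have h2 : |x i| ≤ 1 := abs_le.2 (hx i trivial)
        calc _ ≤ (N : ℝ) * 1 := by gcongr
          _ = N := mul_one _
    _ = _ := by simp

lemma mono_approx (d N : ℕ) (ρ : ℝ) (hρ : 0 < ρ) (s : ℕ → ℝ → ℝ)
    (hs : ∀ k t, |t| < ρ → HasDerivAt (s k) (s (k + 1) t) t) (hs0 : ∀ k, s k 0 ≠ 0)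
    (ε : ℝ) (hε : 0 < ε) (k : Fin d → ℕ) (hk : ∀ i, k i < N) :
    ∀ᶠ h in nhdsWithin (0 : ℝ) (Set.Ioi 0), ∃ w : (Fin d → Fin N) → ℝ, ∀ x ∈ symCube d,
      |∏ i, x i ^ k i - ∑ j, w j * s 0 (h * ∑ i, ((j i : ℕ) : ℝ) * x i)| ≤ ε := by
  set n := ∑ i, k i with hn
  obtain ⟨K, δ, hK, hδ, -, hT⟩ := chain_taylor0 ρ hρ (n + 1) s hs
  set W : (Fin d → Fin N) → ℝ := fun j => ∏ i, wt (k i) (j i) with hW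
  set J : ℝ := d * N with hJ
  have hJ0 : 0 ≤ J := by positivity
  set Q : ℝ := (∑ j, |W j|) * (K * J ^ (n + 1)) with hQ
  have hsn : 0 < |s n 0| := abs_pos.2 (hs0 n)
  have t1 : ∀ᶠ h in nhdsWithin (0 : ℝ) (Set.Ioi 0), h * J < δ := by
    have : Filter.Tendsto (fun h : ℝ => h * J) (nhdsWithin 0 (Set.Ioi 0)) (nhds (0 * J)) :=
      ((continuous_id.mul continuous_const).tendsto 0).mono_left nhdsWithin_le_nhds
    rw [zero_mul] at this
    exact this.eventually_lt_const hδ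
  have t2 : ∀ᶠ h in nhdsWithin (0 : ℝ) (Set.Ioi 0), h * Q < ε * |s n 0| := by
    have : Filter.Tendsto (fun h : ℝ => h * Q) (nhdsWithin 0 (Set.Ioi 0)) (nhds (0 * Q)) :=
      ((continuous_id.mul continuous_const).tendsto 0).mono_left nhdsWithin_le_nhds
    rw [zero_mul] at this
    exact this.eventually_lt_const (by positivity)
  filter_upwards [t1, t2, self_mem_nhdsWithin] with h h1 h2 h0
  have h0 : 0 < h := h0
  refine ⟨fun j => W j / (s n 0 * h ^ n), fun x hx => ?_⟩
  set y : (Fin d → Fin N) → ℝ := fun j => ∑ i, ((j i : ℕ) : ℝ) * x i with hy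
  have hyb : ∀ j, |y j| ≤ J := fun j => dot_bound j x hx
  have hmain : ∑ j, W j * ∑ i ∈ Finset.range (n + 1), s i 0 / i.factorial * (h * y j) ^ i =
      s n 0 * h ^ n * ∏ i, x i ^ k i := by
    have e : ∀ i, ∑ j, W j * (s i 0 / i.factorial * (h * y j) ^ i) =
        s i 0 / i.factorial * h ^ i * ∑ j, W j * y j ^ i := by
      intro i
      rw [Finset.mul_sum]
      refine Finset.sum_congr rfl fun j _ => ?_
      rw [mul_pow]; ring
    simp only [Finset.mul_sum]
    rw [Finset.sum_comm]
    simp only [e]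
    rw [Finset.sum_range_succ, Finset.sum_eq_zero, zero_add]
    · have := W_eq N k hk x
      simp only [hW, hy]
      rw [← hn] at this
      rw [this]
      have : (n.factorial : ℝ) ≠ 0 := by exact_mod_cast n.factorial_ne_zero
      field_simp
    · intro i hi
      have := W_lt N k hk x i (Finset.mem_range.1 hi)
      simp only [hW, hy]
      rw [this, mul_zero]
  have hcn : s n 0 * h ^ n ≠ 0 := mul_ne_zero (hs0 n) (pow_pos h0 n).ne'
  have hdiff : ∏ i, x i ^ k i - ∑ j, W j / (s n 0 * h ^ n) * s 0 (h * y j) =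
      - (∑ j, W j * (s 0 (h * y j) - ∑ i ∈ Finset.range (n + 1), s i 0 / i.factorial * (h * y j) ^ i)) /
        (s n 0 * h ^ n) := by
    simp only [mul_sub]
    rw [Finset.sum_sub_distrib, hmain]
    rw [eq_div_iff hcn, sub_mul, Finset.sum_mul]
    have : ∑ j, W j / (s n 0 * h ^ n) * s 0 (h * y j) * (s n 0 * h ^ n) = ∑ j, W j * s 0 (h * y j) := by
      refine Finset.sum_congr rfl fun j _ => ?_
      rw [mul_right_comm, div_mul_cancel₀ _ hcn]
    rw [this]; ring
  rw [hdiff, abs_div, abs_neg, abs_mul, abs_of_pos (pow_pos h0 n), div_le_iff₀ (by positivity)]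
  calc _ ≤ ∑ j, |W j| * (K * (h * J) ^ (n + 1)) := by
        refine (Finset.abs_sum_le_sum_abs _ _).trans (Finset.sum_le_sum fun j _ => ?_)
        rw [abs_mul]
        have hu : |h * y j| ≤ h * J := by
          rw [abs_mul, abs_of_pos h0]
          gcongr
          exact hyb j
        have := hT (h * y j) (hu.trans h1.le)
        gcongr
        refine this.trans ?_
        gcongr
    _ = h * Q * h ^ n := by
        rw [← Finset.sum_mul, hQ, mul_pow, pow_succ h]; ring
    _ ≤ ε * |s n 0| * h ^ n := by gcongr
    _ = _ := by ring

lemma ridge_approx (d N : ℕ) (ρ : ℝ) (hρ : 0 < ρ) (s : ℕ → ℝ → ℝ)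
    (hs : ∀ k t, |t| < ρ → HasDerivAt (s k) (s (k + 1) t) t) (hs0 : ∀ k, s k 0 ≠ 0)
    (ε : ℝ) (hε : 0 < ε) {ι : Type} [Finite ι] (e : ι → Fin d → ℕ) (he : ∀ a i, e a i < N) :
    ∃ h : ℝ, 0 < h ∧ (∀ (j : Fin d → Fin N), ∀ x ∈ symCube d, |h * ∑ i, ((j i : ℕ) : ℝ) * x i| < ρ) ∧
      ∃ w : ι → (Fin d → Fin N) → ℝ, ∀ a, ∀ x ∈ symCube d,
      |∏ i, x i ^ e a i - ∑ j, w a j * s 0 (h * ∑ i, ((j i : ℕ) : ℝ) * x i)| ≤ ε := by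
  have h1 := Filter.eventually_all.2 fun a => mono_approx d N ρ hρ s hs hs0 ε hε (e a) (he a)
  have h2 : ∀ᶠ h in nhdsWithin (0 : ℝ) (Set.Ioi 0), h * (d * N) < ρ := by
    have : Filter.Tendsto (fun h : ℝ => h * (d * N : ℝ)) (nhdsWithin 0 (Set.Ioi 0)) (nhds (0 * (d * N : ℝ))) :=
      ((continuous_id.mul continuous_const).tendsto 0).mono_left nhdsWithin_le_nhds
    rw [zero_mul] at this
    exact this.eventually_lt_const hρ
  obtain ⟨h, ha, hb, hc⟩ := (h1.and (h2.and self_mem_nhdsWithin)).exists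
  have hc : 0 < h := hc
  choose w hw using ha
  refine ⟨h, hc, fun j x hx => ?_, w, hw⟩
  refine lt_of_le_of_lt ?_ hb
  rw [abs_mul, abs_of_pos hc]
  gcongr
  exact dot_bound j x hx

lemma phi_chain {d' : ℕ} (i0 : Fin d') (φ : (Fin d' → ℝ) → ℝ) (b : Fin d' → ℝ) (ρ : ℝ)
    (hφ : ContDiffOn ℝ (⊤ : ℕ∞) φ (Metric.ball b ρ)) :
    ∀ k t, |t| < ρ → HasDerivAt (fun t => (partialDeriv i0)^[k] φ (fun i => (Pi.single i0 t : Fin d' → ℝ) i + b i))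
      ((partialDeriv i0)^[k + 1] φ (fun i => (Pi.single i0 t : Fin d' → ℝ) i + b i)) t := by
  have hsm : ∀ k, ContDiffOn ℝ (⊤ : ℕ∞) ((partialDeriv i0)^[k] φ) (Metric.ball b ρ) := by
    intro k
    induction k with
    | zero => exact hφ
    | succ k ih =>
      rw [Function.iterate_succ_apply']
      exact (ih.fderiv_of_isOpen Metric.isOpen_ball (m := (⊤ : ℕ∞)) (by simp)).clm_apply contDiffOn_const
  intro k t ht
  rw [Function.iterate_succ_apply']
  have hmem : (fun i => (Pi.single i0 t : Fin d' → ℝ) i + b i) ∈ Metric.ball b ρ := by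
    rw [mem_ball_iff_norm]
    have : (fun i => (Pi.single i0 t : Fin d' → ℝ) i + b i) - b = Pi.single i0 t := by
      funext i; simp
    rw [this, Pi.norm_single]
    exact ht
  have hd := ((hsm k).differentiableOn (by simp) _ hmem).differentiableAt (Metric.isOpen_ball.mem_nhds hmem)
  have hl : HasDerivAt (fun t : ℝ => (fun i => (Pi.single i0 t : Fin d' → ℝ) i + b i)) (Pi.single i0 1) t := by
    rw [hasDerivAt_pi]
    intro i
    refine HasDerivAt.add_const _ ?_
    by_cases h : i = i0
    · subst h
      simpa using hasDerivAt_id' t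
    · simpa [h] using hasDerivAt_const t (0 : ℝ)
  exact hd.hasFDerivAt.comp_hasDerivAt t hl

lemma choose_m (d r L n : ℕ) (hd : 1 ≤ d) (hL : 1 ≤ L) (hn : 1 ≤ n) :
    ∃ m : ℕ, (L * m) ^ d ≤ n ∧
      (m = 0 → (1 : ℝ) ≤ (2 * L) ^ r * (n : ℝ) ^ (-(r : ℝ) / (d : ℝ))) ∧
      (1 ≤ m → 1 / (m : ℝ) ^ r ≤ (2 * L) ^ r * (n : ℝ) ^ (-(r : ℝ) / (d : ℝ))) := by
  set y : ℝ := (n : ℝ) ^ ((1 : ℝ) / d) with hy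
  have hn0 : (0 : ℝ) < n := by exact_mod_cast hn
  have hy0 : 0 < y := Real.rpow_pos_of_pos hn0 _
  have hd0 : (d : ℝ) ≠ 0 := by positivity
  have hyd : y ^ d = n := by
    rw [hy, ← Real.rpow_natCast, ← Real.rpow_mul hn0.le, one_div_mul_cancel hd0, Real.rpow_one]
  have hyr : (n : ℝ) ^ (-(r : ℝ) / (d : ℝ)) = 1 / y ^ r := by
    rw [hy, ← Real.rpow_natCast, ← Real.rpow_mul hn0.le, one_div, ← Real.rpow_neg hn0.le]
    congr 1; ring
  set t : ℕ := ⌊y⌋₊ with ht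
  set m : ℕ := t / L with hm
  have h1 : L * m ≤ t := Nat.mul_div_le t L
  have h2 : t + 1 ≤ L * (m + 1) := Nat.lt_mul_div_succ t hL
  have h3 : y < L * (m + 1) := by
    refine (Nat.lt_floor_add_one y).trans_le ?_
    exact_mod_cast h2
  have hLR : (1 : ℝ) ≤ L := by exact_mod_cast hL
  refine ⟨m, ?_, ?_, ?_⟩
  · have : ((L * m : ℕ) : ℝ) ≤ y := le_trans (by exact_mod_cast h1) (Nat.floor_le hy0.le)
    have h4 : ((L * m : ℕ) : ℝ) ^ d ≤ y ^ d := by gcongr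
    rw [hyd] at h4
    exact_mod_cast h4
  · intro h0
    rw [hyr, mul_one_div, le_div_iff₀ (by positivity), one_mul]
    gcongr
    rw [h0] at h3
    simp at h3
    linarith
  · intro h0
    have hmR : (1 : ℝ) ≤ m := by exact_mod_cast h0
    rw [hyr, mul_one_div, div_le_div_iff₀ (by positivity) (by positivity), one_mul, ← mul_pow]
    gcongr
    nlinarith

/-- Mhaskar's approximation theorem for one-hidden-layer networks: if
`φ : ℝ^{d'} → ℝ` is infinitely differentiable on an open ball around `b` with
all partial derivatives nonvanishing at `b`, then for every `n` there are
`d'×d` matrices `A_1, …, A_n` (independent of `f`) such that every `f` of class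
`C^r` on `[-1,1]^d` admits coefficients `a_j(f)` with
`‖f − Σ_j a_j(f) φ(A_j(·)+b)‖_p ≤ c n^{-r/d} ‖f‖_{W^p_{r,d}}`. -/
theorem mhaskar_one_layer_approx
    (d' d r : ℕ) (hd'1 : 1 ≤ d') (hd'd : d' ≤ d) (hr : 1 ≤ r) (hd : 1 ≤ d)
    (p : ℝ≥0∞) (hp : 1 ≤ p)
    (φ : (Fin d' → ℝ) → ℝ) (b : Fin d' → ℝ) (ρ : ℝ) (hρ : 0 < ρ)
    (hφ : ContDiffOn ℝ (⊤ : ℕ∞) φ (Metric.ball b ρ))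
    (hD : ∀ k : Fin d' → ℕ, multiPartial k φ b ≠ 0) :
    ∃ c : ℝ, 0 < c ∧
      ∀ n : ℕ, 1 ≤ n →
        ∃ A : Fin n → Matrix (Fin d') (Fin d) ℝ,
          ∀ f : (Fin d → ℝ) → ℝ, ContDiffOn ℝ r f (symCube d) →
            ∃ a : Fin n → ℝ,
              lpNormOnCube d p
                  (fun x => f x - ∑ j, a j * φ (fun i => (A j).mulVec x i + b i))
                ≤ ENNReal.ofReal (c * (n : ℝ) ^ (-(r : ℝ) / (d : ℝ))) * sobolevNorm d r p f := by
  obtain ⟨q, rfl⟩ : ∃ q, r = q + 1 := ⟨r - 1, by omega⟩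
  set i0 : Fin d' := ⟨0, hd'1⟩ with hi0
  set s : ℕ → ℝ → ℝ := fun k t =>
    (partialDeriv i0)^[k] φ (fun i => (Pi.single i0 t : Fin d' → ℝ) i + b i) with hsdef
  have hs : ∀ k t, |t| < ρ → HasDerivAt (s k) (s (k + 1) t) t := phi_chain i0 φ b ρ hφ
  have hs0 : ∀ k, s k 0 ≠ 0 := by
    intro k
    have := hD (Pi.single i0 k)
    rw [multiPartial_single] at this
    simpa [hsdef] using this
  obtain ⟨C, L, hC, hL, H⟩ := ddim d q hd
  have hLR : (1 : ℝ) ≤ L := by exact_mod_cast hL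
  refine ⟨(C + 1) * (2 * L) ^ (q + 1), by positivity, fun n hn => ?_⟩
  obtain ⟨m, hmn, hm0, hm1⟩ := choose_m d (q + 1) L n hd hL hn
  rcases Nat.eq_zero_or_pos m with hm | hm
  · refine ⟨fun _ => 0, fun f hf => ⟨fun _ => 0, ?_⟩⟩
    have h1 := le_sobolev (r := q + 1) p f (Pi.single ⟨0, hd⟩ 0) (by simp)
    rw [multiPartial_single] at h1
    simp only [zero_mul, Finset.sum_const_zero, sub_zero]
    refine h1.trans (le_mul_of_one_le_left' ?_)
    rw [← ENNReal.ofReal_one]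
    refine ENNReal.ofReal_le_ofReal ?_
    rw [mul_assoc]
    nlinarith [hm0 hm]
  · obtain ⟨ι, fι, e, M, hM, he, hf⟩ := H m hm
    set N := L * m with hN
    have hmR : (0 : ℝ) < m := by exact_mod_cast hm
    set P : ℝ := 2 ^ d * (Fintype.card ι * M) with hP
    have hP0 : 0 ≤ P := by positivity
    set ε : ℝ := 1 / (m ^ (q + 1) * (P + 1)) with hε
    have hε0 : 0 < ε := by positivity
    obtain ⟨h, hh0, hhρ, w, hw⟩ := ridge_approx d N ρ hρ s hs hs0 ε hε0 e he
    obtain ⟨g⟩ : Nonempty ((Fin d → Fin N) ↪ Fin n) :=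
      Function.Embedding.nonempty_of_card_le (by simpa using hmn)
    set Mat : (Fin d → Fin N) → Matrix (Fin d') (Fin d) ℝ := fun j =>
      Matrix.of fun i' i => if i' = i0 then h * ((j i : ℕ) : ℝ) else 0 with hMat
    have hMv : ∀ j x, φ (fun i => (Mat j).mulVec x i + b i) = s 0 (h * ∑ i, ((j i : ℕ) : ℝ) * x i) := by
      intro j x
      simp only [hsdef, Function.iterate_zero, id]
      congr 1
      funext i
      congr 1
      simp only [Matrix.mulVec, dotProduct, hMat, Matrix.of_apply]
      by_cases hi : i = i0
      · subst hi
        simp only [if_true, Pi.single_eq_same, Finset.mul_sum]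
        exact Finset.sum_congr rfl fun _ _ => by ring
      · simp [hi]
    refine ⟨Function.extend g Mat 0, fun f hfc => ?_⟩
    obtain ⟨c, hc, hcf⟩ := hf f hfc p hp
    set a0 : (Fin d → Fin N) → ℝ := fun j => ∑ α, c α * w α j with ha0
    refine ⟨Function.extend g a0 0, ?_⟩
    have hsum : ∀ x, ∑ t, Function.extend g a0 0 t *
        φ (fun i => (Function.extend g Mat 0 t).mulVec x i + b i) =
        ∑ j, a0 j * s 0 (h * ∑ i, ((j i : ℕ) : ℝ) * x i) := by
      intro x
      symm
      refine Fintype.sum_of_injective g g.injective _ _ ?_ ?_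
      · intro t ht
        rw [Function.extend_apply' _ _ _ ht]
        simp
      · intro j
        rw [g.injective.extend_apply, g.injective.extend_apply, hMv]
    simp only [hsum]
    set S := sobolevNorm d (q + 1) p f with hS
    set U1 : (Fin d → ℝ) → ℝ := fun x => f x - ∑ α, (∏ j, x j ^ e α j) * c α with hU1
    set R : ι → (Fin d → ℝ) → ℝ := fun α x =>
      ∏ i, x i ^ e α i - ∑ j, w α j * s 0 (h * ∑ i, ((j i : ℕ) : ℝ) * x i) with hR
    have hsplit : (fun x => f x - ∑ j, a0 j * s 0 (h * ∑ i, ((j i : ℕ) : ℝ) * x i)) =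
        U1 + fun x => ∑ α, c α * R α x := by
      funext x
      simp only [hU1, hR, Pi.add_apply, mul_sub, Finset.sum_sub_distrib, ha0, Finset.sum_mul, Finset.mul_sum]
      rw [Finset.sum_comm (s := Finset.univ (α := Fin d → Fin N))]
      simp only [mul_assoc, mul_comm (c _)]
      ring
    have hRc : ∀ α, ContinuousOn (R α) (symCube d) := by
      intro α
      refine ContinuousOn.sub (by fun_prop) ?_
      refine continuousOn_finsetSum _ fun j _ => continuousOn_const.mul ?_
      intro x hx
      have h1 : ContinuousAt (s 0) (h * ∑ i, ((j i : ℕ) : ℝ) * x i) := (hs 0 _ (hhρ j x hx)).continuousAt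
      refine ContinuousAt.continuousWithinAt ?_
      exact ContinuousAt.comp (f := fun x : Fin d → ℝ => h * ∑ i, ((j i : ℕ) : ℝ) * x i) h1
        (Continuous.continuousAt (by fun_prop))
    have hm1' : AEStronglyMeasurable U1 (muC d) := by
      refine ContinuousOn.aestronglyMeasurable ?_ (measurableSet_symCube d)
      exact hfc.continuousOn.sub (by fun_prop)
    have hm2' : AEStronglyMeasurable (fun x => ∑ α, c α * R α x) (muC d) := by
      refine ContinuousOn.aestronglyMeasurable ?_ (measurableSet_symCube d)
      exact continuousOn_finsetSum _ fun α _ => continuousOn_const.mul (hRc α)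
    have hb2 : eLpNorm (fun x => ∑ α, c α * R α x) p (muC d) ≤ ENNReal.ofReal (1 / m ^ (q + 1)) * S := by
      have hpt : ∀ᵐ x ∂(muC d), ‖∑ α, c α * R α x‖ₑ ≤
          Fintype.card ι * (ENNReal.ofReal M * S * ENNReal.ofReal ε) := by
        refine (ae_restrict_iff' (measurableSet_symCube d)).2 (Filter.Eventually.of_forall fun x hx => ?_)
        refine (enorm_sum_le _ _).trans ?_
        calc _ ≤ ∑ _α : ι, ENNReal.ofReal M * S * ENNReal.ofReal ε := by
              refine Finset.sum_le_sum fun α _ => ?_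
              rw [enorm_mul]
              refine mul_le_mul' (hc α) ?_
              rw [← ofReal_norm]
              exact ENNReal.ofReal_le_ofReal (hw α x hx)
          _ = _ := by simp
      refine (eLpNorm_le_of_ae_enorm_bound hpt).trans ?_
      have hμ : (muC d Set.univ) ^ (p.toReal⁻¹) ≤ ENNReal.ofReal (2 ^ d) := by
        rw [muC_univ]
        calc _ ≤ ((2 : ℝ≥0∞) ^ d) ^ (1 : ℝ) := by
              refine ENNReal.rpow_le_rpow_of_exponent_le (one_le_pow₀ (by norm_num)) ?_
              rcases eq_or_ne p ∞ with rfl | hpt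
              · simp
              · refine inv_le_one_of_one_le₀ ?_
                rw [← ENNReal.toReal_one]
                exact ENNReal.toReal_mono hpt hp
          _ = _ := by
              rw [ENNReal.rpow_one, ENNReal.ofReal_pow (by norm_num)]; simp
      rw [smul_eq_mul]
      calc _ ≤ Fintype.card ι * (ENNReal.ofReal M * S * ENNReal.ofReal ε) * ENNReal.ofReal (2 ^ d) := by gcongr
        _ = ENNReal.ofReal (P * ε) * S := by
            rw [hP, ENNReal.ofReal_mul (by positivity), ENNReal.ofReal_mul (by positivity),
              ENNReal.ofReal_mul (by positivity), ENNReal.ofReal_natCast]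
            ring
        _ ≤ _ := by
            gcongr
            rw [hε, mul_one_div, div_le_div_iff₀ (by positivity) (by positivity)]
            have : 0 < (m : ℝ) ^ (q + 1) := by positivity
            nlinarith
    rw [hsplit]
    calc _ ≤ eLpNorm U1 p (muC d) + eLpNorm (fun x => ∑ α, c α * R α x) p (muC d) :=
          eLpNorm_add_le hm1' hm2' hp
      _ ≤ ENNReal.ofReal (C / m ^ (q + 1)) * S + ENNReal.ofReal (1 / m ^ (q + 1)) * S := add_le_add hcf hb2
      _ = ENNReal.ofReal ((C + 1) * (1 / m ^ (q + 1))) * S := by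
          rw [← add_mul, ← ENNReal.ofReal_add (by positivity) (by positivity)]
          congr 2; ring
      _ ≤ _ := by
          have h1 := hm1 hm
          refine mul_le_mul_left (ENNReal.ofReal_le_ofReal ?_) _
          rw [mul_assoc]
          exact mul_le_mul_of_nonneg_left h1 (by positivity)
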